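/- arXiv:1005.4583 — 2 statements merged into one kernel-verified Lean document; each statement's English description precedes it below -/
import Mathlib

section
/- For all integers n ≥ 1, k ≥ 0 and j ≥ 0, the following identity holds in ℤ[p,q]: Σ_{σ∈S_{n,k,j}} p^{nest σ} q^{cros σ} = Σ_{σ∈S*_{n,k,j}} p^{ress σ} q^{les σ}, where S_{n,k,j} is the set of permutations of [n] with exactly k cyclic valleys, exactly j fixed points, and no double excedances, and S*_{n,k,j} is the set of permutations of [n] with exactly k valleys and exactly j double ascents, all of which are foremaxima. -/
open scoped Classical
open Finset

noncomputable section

namespace SZpaper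

/-- `σ` as a 1-indexed function on `[1,n]`, extended by `0` elsewhere
(boundary convention `σ(0)=σ(n+1)=0`). -/
def pext (n : ℕ) (σ : Equiv.Perm (Fin n)) (i : ℕ) : ℕ :=
  if h : 1 ≤ i ∧ i ≤ n then ((σ ⟨i - 1, by omega⟩ : Fin n) : ℕ) + 1 else 0

/-- `σ` extended with the Brändén boundary convention `σ(0)=σ(n+1)=n+1`. -/
def pextB (n : ℕ) (σ : Equiv.Perm (Fin n)) (i : ℕ) : ℕ :=
  if h : 1 ≤ i ∧ i ≤ n then ((σ ⟨i - 1, by omega⟩ : Fin n) : ℕ) + 1 else n + 1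

/-- `σ` extended with the boundary convention `σ(0)=0`, `σ(n+1)=n+1`. -/
def pextC (n : ℕ) (σ : Equiv.Perm (Fin n)) (i : ℕ) : ℕ :=
  if h : 1 ≤ i ∧ i ≤ n then ((σ ⟨i - 1, by omega⟩ : Fin n) : ℕ) + 1
  else if i = 0 then 0 else n + 1

/-- The set of pairs `(i,j)` with `i, j ∈ [1,n]`. -/
def pairs (n : ℕ) : Finset (ℕ × ℕ) := Finset.Icc 1 n ×ˢ Finset.Icc 1 n

/-- `des σ = #{i ∈ [n−1] : σ(i) > σ(i+1)}`. -/
def desStat (n : ℕ) (σ : Equiv.Perm (Fin n)) : ℕ :=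
  ((Finset.Icc 1 (n - 1)).filter fun i => pext n σ (i + 1) < pext n σ i).card

/-- `les σ = #{(i,j) : 2 ≤ i < j ≤ n, σ(i−1) > σ(j) > σ(i)}`. -/
def lesStat (n : ℕ) (σ : Equiv.Perm (Fin n)) : ℕ :=
  ((pairs n).filter fun x => 2 ≤ x.1 ∧ x.1 < x.2 ∧
    pext n σ x.1 < pext n σ x.2 ∧ pext n σ x.2 < pext n σ (x.1 - 1)).card

/-- `less σ = #{(i,j) : 2 ≤ i < j ≤ n, σ(i−1) < σ(j) < σ(i)}`. -/
def lessStat (n : ℕ) (σ : Equiv.Perm (Fin n)) : ℕ :=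
  ((pairs n).filter fun x => 2 ≤ x.1 ∧ x.1 < x.2 ∧
    pext n σ (x.1 - 1) < pext n σ x.2 ∧ pext n σ x.2 < pext n σ x.1).card

/-- `res σ = #{(i,j) : 1 ≤ i < j ≤ n−1, σ(j+1) > σ(i) > σ(j)}`. -/
def resStat (n : ℕ) (σ : Equiv.Perm (Fin n)) : ℕ :=
  ((pairs n).filter fun x => x.1 < x.2 ∧ x.2 ≤ n - 1 ∧
    pext n σ x.2 < pext n σ x.1 ∧ pext n σ x.1 < pext n σ (x.2 + 1)).card

/-- `ress σ = #{(i,j) : 1 ≤ i < j ≤ n−1, σ(j+1) < σ(i) < σ(j)}`. -/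
def ressStat (n : ℕ) (σ : Equiv.Perm (Fin n)) : ℕ :=
  ((pairs n).filter fun x => x.1 < x.2 ∧ x.2 ≤ n - 1 ∧
    pext n σ (x.2 + 1) < pext n σ x.1 ∧ pext n σ x.1 < pext n σ x.2).card

/-! Linear statistics with the boundary convention `σ(0)=σ(n+1)=0` (starred). -/

def peakStar (n : ℕ) (σ : Equiv.Perm (Fin n)) : ℕ :=
  ((Finset.Icc 1 n).filter fun i =>
    pext n σ (i - 1) < pext n σ i ∧ pext n σ (i + 1) < pext n σ i).card

def valleyStar (n : ℕ) (σ : Equiv.Perm (Fin n)) : ℕ :=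
  ((Finset.Icc 1 n).filter fun i =>
    pext n σ i < pext n σ (i - 1) ∧ pext n σ i < pext n σ (i + 1)).card

def daStar (n : ℕ) (σ : Equiv.Perm (Fin n)) : ℕ :=
  ((Finset.Icc 1 n).filter fun i =>
    pext n σ (i - 1) < pext n σ i ∧ pext n σ i < pext n σ (i + 1)).card

def ddStar (n : ℕ) (σ : Equiv.Perm (Fin n)) : ℕ :=
  ((Finset.Icc 1 n).filter fun i =>
    pext n σ (i + 1) < pext n σ i ∧ pext n σ i < pext n σ (i - 1)).card

/-! Linear statistics with the Brändén boundary convention `σ(0)=σ(n+1)=n+1`. -/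

def peakB (n : ℕ) (σ : Equiv.Perm (Fin n)) : ℕ :=
  ((Finset.Icc 1 n).filter fun i =>
    pextB n σ (i - 1) < pextB n σ i ∧ pextB n σ (i + 1) < pextB n σ i).card

def valleyB (n : ℕ) (σ : Equiv.Perm (Fin n)) : ℕ :=
  ((Finset.Icc 1 n).filter fun i =>
    pextB n σ i < pextB n σ (i - 1) ∧ pextB n σ i < pextB n σ (i + 1)).card

def daB (n : ℕ) (σ : Equiv.Perm (Fin n)) : ℕ :=
  ((Finset.Icc 1 n).filter fun i =>
    pextB n σ (i - 1) < pextB n σ i ∧ pextB n σ i < pextB n σ (i + 1)).card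

def ddB (n : ℕ) (σ : Equiv.Perm (Fin n)) : ℕ :=
  ((Finset.Icc 1 n).filter fun i =>
    pextB n σ (i + 1) < pextB n σ i ∧ pextB n σ i < pextB n σ (i - 1)).card

/-! Linear statistics with the boundary convention `σ(0)=0`, `σ(n+1)=n+1`. -/

def valleyC (n : ℕ) (σ : Equiv.Perm (Fin n)) : ℕ :=
  ((Finset.Icc 1 n).filter fun i =>
    pextC n σ i < pextC n σ (i - 1) ∧ pextC n σ i < pextC n σ (i + 1)).card

def daC (n : ℕ) (σ : Equiv.Perm (Fin n)) : ℕ :=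
  ((Finset.Icc 1 n).filter fun i =>
    pextC n σ (i - 1) < pextC n σ i ∧ pextC n σ i < pextC n σ (i + 1)).card

def ddC (n : ℕ) (σ : Equiv.Perm (Fin n)) : ℕ :=
  ((Finset.Icc 1 n).filter fun i =>
    pextC n σ (i + 1) < pextC n σ i ∧ pextC n σ i < pextC n σ (i - 1)).card

/-- `fmax σ`: the number of double ascents (convention `σ(0)=0`, `σ(n+1)=n+1`)
which are left-to-right maxima. -/
def fmaxStat (n : ℕ) (σ : Equiv.Perm (Fin n)) : ℕ :=
  ((Finset.Icc 1 n).filter fun i =>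
    pextC n σ (i - 1) < pextC n σ i ∧ pextC n σ i < pextC n σ (i + 1) ∧
    ∀ j ∈ Finset.Ico 1 i, pext n σ j < pext n σ i).card

/-! Cyclic statistics. -/

def excStat (n : ℕ) (σ : Equiv.Perm (Fin n)) : ℕ :=
  ((Finset.Icc 1 n).filter fun i => i < pext n σ i).card

def wexStat (n : ℕ) (σ : Equiv.Perm (Fin n)) : ℕ :=
  ((Finset.Icc 1 n).filter fun i => i ≤ pext n σ i).card

def dropStat (n : ℕ) (σ : Equiv.Perm (Fin n)) : ℕ :=
  ((Finset.Icc 1 n).filter fun i => pext n σ i < i).card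

def fixStat (n : ℕ) (σ : Equiv.Perm (Fin n)) : ℕ :=
  ((Finset.Icc 1 n).filter fun i => pext n σ i = i).card

/-- cyclic valleys: `x` with `σ⁻¹(x) > x < σ(x)`. -/
def cvalleyStat (n : ℕ) (σ : Equiv.Perm (Fin n)) : ℕ :=
  ((Finset.Icc 1 n).filter fun x => x < pext n σ⁻¹ x ∧ x < pext n σ x).card

/-- double excedances: `x` with `σ⁻¹(x) < x < σ(x)`. -/
def cdaStat (n : ℕ) (σ : Equiv.Perm (Fin n)) : ℕ :=
  ((Finset.Icc 1 n).filter fun x => pext n σ⁻¹ x < x ∧ x < pext n σ x).card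

/-- double drops: `x` with `σ⁻¹(x) > x > σ(x)`. -/
def cddStat (n : ℕ) (σ : Equiv.Perm (Fin n)) : ℕ :=
  ((Finset.Icc 1 n).filter fun x => x < pext n σ⁻¹ x ∧ pext n σ x < x).card

/-- crossings. -/
def crosStat (n : ℕ) (σ : Equiv.Perm (Fin n)) : ℕ :=
  ((pairs n).filter fun x =>
    (x.1 < x.2 ∧ x.2 ≤ pext n σ x.1 ∧ pext n σ x.1 < pext n σ x.2) ∨
    (x.2 < x.1 ∧ pext n σ x.1 < x.2 ∧ pext n σ x.2 < pext n σ x.1)).card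

/-- nestings. -/
def nestStat (n : ℕ) (σ : Equiv.Perm (Fin n)) : ℕ :=
  ((pairs n).filter fun x =>
    (x.1 < x.2 ∧ x.2 ≤ pext n σ x.2 ∧ pext n σ x.2 < pext n σ x.1) ∨
    (x.2 < x.1 ∧ pext n σ x.2 < x.2 ∧ pext n σ x.1 < pext n σ x.2)).card

/-- number of cycles of `σ` (fixed points count as cycles). -/
def cycStat (n : ℕ) (σ : Equiv.Perm (Fin n)) : ℕ :=
  Multiset.card σ.cycleType + (Finset.univ.filter fun x => σ x = x).card

/-! Star statistics: `σ*(i) = σ(i) − 1`, a bijection `[n] → {0,…,n−1}`;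
we extend `σ*` by `0` outside `[1,n]`. -/

def starf (n : ℕ) (σ : Equiv.Perm (Fin n)) (i : ℕ) : ℕ :=
  if 1 ≤ i ∧ i ≤ n then pext n σ i - 1 else 0

/-- `(σ*)⁻¹(i) = σ⁻¹(i+1)`, defined for `0 ≤ i ≤ n−1`. -/
def invstarf (n : ℕ) (σ : Equiv.Perm (Fin n)) (i : ℕ) : ℕ :=
  pext n σ⁻¹ (i + 1)

def dropStarStat (n : ℕ) (σ : Equiv.Perm (Fin n)) : ℕ :=
  ((Finset.Icc 1 n).filter fun i => starf n σ i < i).card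

def fixStarStat (n : ℕ) (σ : Equiv.Perm (Fin n)) : ℕ :=
  ((Finset.Icc 1 n).filter fun i => starf n σ i = i).card

def wexStarStat (n : ℕ) (σ : Equiv.Perm (Fin n)) : ℕ :=
  ((Finset.Icc 1 n).filter fun i => i ≤ starf n σ i).card

def cdaStarStat (n : ℕ) (σ : Equiv.Perm (Fin n)) : ℕ :=
  ((Finset.Icc 1 n).filter fun i => invstarf n σ i < i ∧ i < starf n σ i).card

def cddStarStat (n : ℕ) (σ : Equiv.Perm (Fin n)) : ℕ :=
  ((Finset.Icc 1 n).filter fun i => i < invstarf n σ i ∧ starf n σ i < i).card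

def cvalleyStarStat (n : ℕ) (σ : Equiv.Perm (Fin n)) : ℕ :=
  ((Finset.Icc 1 n).filter fun i => i < invstarf n σ i ∧ i < starf n σ i).card

def crosStarStat (n : ℕ) (σ : Equiv.Perm (Fin n)) : ℕ :=
  ((pairs n).filter fun x =>
    (x.1 < x.2 ∧ x.2 ≤ starf n σ x.1 ∧ starf n σ x.1 < starf n σ x.2) ∨
    (x.2 < x.1 ∧ starf n σ x.1 < x.2 ∧ starf n σ x.2 < starf n σ x.1)).card

def nestStarStat (n : ℕ) (σ : Equiv.Perm (Fin n)) : ℕ :=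
  ((pairs n).filter fun x =>
    (x.1 < x.2 ∧ x.2 ≤ starf n σ x.2 ∧ starf n σ x.2 < starf n σ x.1) ∨
    (x.2 < x.1 ∧ starf n σ x.2 < x.2 ∧ starf n σ x.1 < starf n σ x.2)).card

/-- `cyc* σ`: the number of cycles of the functional digraph of `σ*` on `[n]`,
counted as the number of `i ∈ [1,n]` that lie on a cycle of `σ*` and are
minimal in their cycle. (The component of `σ*` that is a path from `n` to `0`
contributes no such `i`.) -/
def cycStarStat (n : ℕ) (σ : Equiv.Perm (Fin n)) : ℕ :=
  ((Finset.Icc 1 n).filter fun i =>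
    (∃ m ∈ Finset.Icc 1 n, (starf n σ)^[m] i = i) ∧
    ∀ m ∈ Finset.range (n + 1), i ≤ (starf n σ)^[m] i).card

/-! Motzkin paths, encoded as step sequences `γ : Fin m → Fin 3`
(`0` = up step `(1,1)`, `1` = level step `(1,0)`, `2` = down step `(1,−1)`). -/

/-- The height (ordinate) of the path after `i` steps. -/
def hgt (m : ℕ) (γ : Fin m → Fin 3) (i : ℕ) : ℤ :=
  ∑ j ∈ Finset.range i, if hj : j < m then 1 - ((γ ⟨j, hj⟩ : ℕ) : ℤ) else 0

/-- A step sequence is a Motzkin path if it never goes below the x-axis and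
ends at height `0`. -/
def IsMotzkin (m : ℕ) (γ : Fin m → Fin 3) : Prop :=
  (∀ i ≤ m, 0 ≤ hgt m γ i) ∧ hgt m γ m = 0

/-- The (finite) set of Motzkin paths of length `m`. -/
def motzkin (m : ℕ) : Finset (Fin m → Fin 3) :=
  Finset.univ.filter fun γ => IsMotzkin m γ

/-- number of up (North-East) steps. -/
def neCount (m : ℕ) (γ : Fin m → Fin 3) : ℕ :=
  (Finset.univ.filter fun i => γ i = 0).card

/-- number of level (East) steps. -/
def eCount (m : ℕ) (γ : Fin m → Fin 3) : ℕ :=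
  (Finset.univ.filter fun i => γ i = 1).card

/-- the `(p,q)`-integer `[m]_{p,q} = p^{m−1} + p^{m−2}q + ⋯ + q^{m−1}`. -/
def pqInt {R : Type*} [CommRing R] (p q : R) (m : ℕ) : R :=
  ∑ j ∈ Finset.range m, p ^ (m - 1 - j) * q ^ j

/-! ### Sums over weighted histories -/

section Histories

variable {C Ω R : Type*} [CommSemiring R]

/-- The weighted count of `m`-step histories from height `h` down to height `0`, where a step
`c ∈ Ch h` has weight `wt h c` and leads to height `nx h c`. -/
def pathSum (Ch : ℕ → Finset C) (nx : ℕ → C → ℕ) (wt : ℕ → C → R) : ℕ → ℕ → R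
  | 0, h => if h = 0 then 1 else 0
  | m + 1, h => ∑ c ∈ Ch h, wt h c * pathSum Ch nx wt m (nx h c)

/-- The set of `m`-step histories from height `h` down to height `0`. -/
def histories (Ch : ℕ → Finset C) (nx : ℕ → C → ℕ) : ℕ → ℕ → Finset (List C)
  | 0, h => if h = 0 then {[]} else ∅
  | m + 1, h => (Ch h).biUnion fun c => (histories Ch nx m (nx h c)).image (List.cons c)

/-- The weight of a history starting at height `h`. -/
def historyWeight (nx : ℕ → C → ℕ) (wt : ℕ → C → R) : ℕ → List C → R
  | _, [] => 1
  | h, c :: l => wt h c * historyWeight nx wt (nx h c) l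

lemma sum_histories (Ch : ℕ → Finset C) (nx : ℕ → C → ℕ) (wt : ℕ → C → R) (m h : ℕ) :
    ∑ l ∈ histories Ch nx m h, historyWeight nx wt h l = pathSum Ch nx wt m h := by
  induction m generalizing h with
  | zero => by_cases hh : h = 0 <;> simp [histories, pathSum, hh, historyWeight]
  | succ m ih =>
    rw [histories, pathSum, Finset.sum_biUnion]
    · refine Finset.sum_congr rfl fun c _ => ?_
      rw [Finset.sum_image (by simp), ← ih, Finset.mul_sum]
      rfl
    · intro c _ d _ hcd
      simp only [Function.onFun, Finset.disjoint_left, Finset.mem_image]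
      rintro _ ⟨l, _, rfl⟩ ⟨l', _, h'⟩
      exact hcd (List.cons.inj h').1.symm

variable {n : ℕ} {H : ℕ → Ω → ℕ} {c : ℕ → Ω → C} {Ch : ℕ → Finset C} {nx : ℕ → C → ℕ}

lemma map_code_mem_histories (hn : ∀ ω, H n ω = 0)
    (mem : ∀ m < n, ∀ ω, c m ω ∈ Ch (H m ω))
    (step : ∀ m < n, ∀ ω, H (m + 1) ω = nx (H m ω) (c m ω)) (ω : Ω) (r m : ℕ)
    (hm : m + r = n) :
    (List.range' m r).map (c · ω) ∈ histories Ch nx r (H m ω) := by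
  induction r generalizing m with
  | zero => obtain rfl : m = n := by omega
            simp [histories, hn]
  | succ r ih =>
    simp only [List.range'_succ, List.map_cons, histories, Finset.mem_biUnion, Finset.mem_image]
    refine ⟨_, mem m (by omega) ω, _, ?_, rfl⟩
    rw [← step m (by omega)]
    exact ih (m + 1) (by omega)

lemma historyWeight_map_code (wt : ℕ → C → R)
    (step : ∀ m < n, ∀ ω, H (m + 1) ω = nx (H m ω) (c m ω)) (ω : Ω) (r m : ℕ)
    (hm : m + r = n) :
    historyWeight nx wt (H m ω) ((List.range' m r).map (c · ω)) =
      ∏ i ∈ Finset.range r, wt (H (m + i) ω) (c (m + i) ω) := by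
  induction r generalizing m with
  | zero => simp [historyWeight]
  | succ r ih =>
    simp only [List.range'_succ, List.map_cons, historyWeight]
    rw [← step m (by omega), ih (m + 1) (by omega), Finset.prod_range_succ', mul_comm]
    simp [add_assoc, add_comm 1]

/-- If objects are encoded injectively by histories, and there are as many objects as histories,
then the total weight of the objects is the weighted count of histories. -/
lemma sum_eq_pathSum [Fintype Ω] (h0 : ∀ ω, H 0 ω = 0) (hn : ∀ ω, H n ω = 0)
    (mem : ∀ m < n, ∀ ω, c m ω ∈ Ch (H m ω))
    (step : ∀ m < n, ∀ ω, H (m + 1) ω = nx (H m ω) (c m ω))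
    (inj : ∀ ω ω', (∀ m < n, c m ω = c m ω') → ω = ω')
    (card : pathSum Ch nx (fun _ _ => (1 : ℕ)) n 0 = Fintype.card Ω) (wt : ℕ → C → R) :
    ∑ ω, ∏ m ∈ Finset.range n, wt (H m ω) (c m ω) = pathSum Ch nx wt n 0 := by
  have hinj : Function.Injective fun ω => (List.range' 0 n).map (c · ω) := by
    intro ω ω' h
    refine inj ω ω' fun m hm => ?_
    exact List.map_inj_left.1 h m (by simpa using hm)
  have himg : Finset.univ.image (fun ω => (List.range' 0 n).map (c · ω)) =
      histories Ch nx n 0 := by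
    refine Finset.eq_of_subset_of_card_le ?_ ?_
    · intro l hl
      obtain ⟨ω, -, rfl⟩ := Finset.mem_image.1 hl
      simpa [h0] using map_code_mem_histories hn mem step ω n 0 (by simp)
    · rw [Finset.card_image_of_injective _ hinj, Finset.card_univ, ← card, ← sum_histories,
        Finset.card_eq_sum_ones]
      refine Finset.sum_le_sum fun l _ => le_of_eq ?_
      have : ∀ (l : List C) (h : ℕ), historyWeight nx (fun _ _ => (1 : ℕ)) h l = 1 := by
        intro l
        induction l with
        | nil => intro h; rfl
        | cons a l ih => intro h; simp [historyWeight, ih]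
      exact (this l 0).symm
  rw [← sum_histories, ← himg, Finset.sum_image (fun _ _ _ _ h => hinj h)]
  refine Finset.sum_congr rfl fun ω _ => ?_
  have := historyWeight_map_code wt step ω n 0 (by simp)
  simpa [h0] using this.symm

end Histories

/-! ### Linear and cyclic histories -/

section Steps

variable {R : Type*} [CommSemiring R]

/-- The possible steps at height `h` of the history of a permutation seen as a word: valleys,
double ascents, double descents and peaks. -/
def linSteps (h : ℕ) : Finset ((ℕ ⊕ ℕ) ⊕ (ℕ ⊕ ℕ)) :=
  ((range (h + 1)).disjSum (range (h + 1))).disjSum ((range h).disjSum (range h))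

/-- The possible steps at height `h` of the history of a permutation seen as a product of cycles:
cyclic valleys, double excedances or fixed points, double drops and cyclic peaks. -/
def cycSteps (h : ℕ) : Finset ((Unit ⊕ ℕ) ⊕ (ℕ ⊕ (ℕ × ℕ))) :=
  (({()} : Finset Unit).disjSum (range (h + 1))).disjSum
    ((range h).disjSum (range h ×ˢ range h))

/-- The height after a step: it goes up, stays, stays, or goes down according to the type. -/
def nextHeight {α β γ δ : Type*} (h : ℕ) : (α ⊕ β) ⊕ (γ ⊕ δ) → ℕ :=
  Sum.elim (Sum.elim (fun _ => h + 1) (fun _ => h)) (Sum.elim (fun _ => h) (fun _ => h - 1))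

/-- The weight of a step of a linear history. -/
def linWeight (p q t x y : R) (h : ℕ) : (ℕ ⊕ ℕ) ⊕ (ℕ ⊕ ℕ) → R :=
  Sum.elim
    (Sum.elim (fun b => t * (p ^ (h - b) * q ^ b))
      (fun b => (if b = 0 then x else y) * (p ^ (h - b) * q ^ b)))
    (Sum.elim (fun b => p ^ (h - 1 - b) * q ^ b) (fun b => p ^ (h - 1 - b) * q ^ b))

/-- The weight of a step of a cyclic history. -/
def cycWeight (p q t x y : R) (h : ℕ) : (Unit ⊕ ℕ) ⊕ (ℕ ⊕ (ℕ × ℕ)) → R :=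
  Sum.elim
    (Sum.elim (fun _ => t)
      (fun b => (if b = 0 then x else y) * (p ^ (h - b) * q ^ b)))
    (Sum.elim (fun c => p ^ (h - 1 - c) * q ^ c)
      (fun bc => (p ^ (h - 1 - bc.1) * q ^ bc.1) * (p ^ (h - 1 - bc.2) * q ^ bc.2)))

/-- The `(p,q)`-integer, over a semiring. -/
def pqSum (p q : R) (h : ℕ) : R := ∑ b ∈ range h, p ^ (h - 1 - b) * q ^ b

lemma cyc_pathSum_eq (p q t x y : R) (m h : ℕ) :
    pathSum cycSteps nextHeight (cycWeight p q t x y) m h =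
      (∏ i ∈ range h, pqSum p q (i + 1)) *
        pathSum linSteps nextHeight (linWeight p q t x y) m h := by
  induction m generalizing h with
  | zero => by_cases hh : h = 0 <;> simp [pathSum, hh]
  | succ m ih =>
    have key : ∀ P : R, ∑ bc ∈ range h ×ˢ range h,
        (p ^ (h - 1 - bc.1) * q ^ bc.1) * (p ^ (h - 1 - bc.2) * q ^ bc.2) * P =
          pqSum p q h * pqSum p q h * P := by
      intro P
      rw [← Finset.sum_mul, pqSum, Finset.sum_mul_sum, Finset.sum_product]
    simp only [pathSum, cycSteps, linSteps, Finset.sum_disjSum, cycWeight, linWeight, nextHeight,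
      Sum.elim_inl, Sum.elim_inr, Finset.sum_singleton]
    rw [key]
    simp only [ih]
    have up : ∑ b ∈ range (h + 1), t * (p ^ (h - b) * q ^ b) *
        pathSum linSteps nextHeight (linWeight p q t x y) m (h + 1) =
          t * pqSum p q (h + 1) *
            pathSum linSteps nextHeight (linWeight p q t x y) m (h + 1) := by
      rw [← Finset.sum_mul, ← Finset.mul_sum, pqSum]
      simp
    have lv : ∀ P : R, ∑ b ∈ range h, p ^ (h - 1 - b) * q ^ b * P = pqSum p q h * P := by
      intro P
      rw [← Finset.sum_mul, pqSum]
    rw [up]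
    simp only [lv, ← Finset.sum_mul, Finset.prod_range_succ]
    rcases h with _ | h
    · simp [pqSum]
    · simp only [Nat.add_sub_cancel, Finset.prod_range_succ]
      ring

lemma lin_pathSum_one (m h : ℕ) :
    pathSum linSteps nextHeight (fun _ _ => (1 : ℕ)) m h = m.factorial * m.choose h := by
  induction m generalizing h with
  | zero => rcases h with _ | h <;> simp [pathSum]
  | succ m ih =>
    simp only [pathSum, linSteps, Finset.sum_disjSum, nextHeight, Sum.elim_inl, Sum.elim_inr, ih,
      Finset.sum_const, Finset.card_range, smul_eq_mul, one_mul]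
    rw [Nat.factorial_succ]
    rcases h with _ | h
    · simp; ring
    · have e1 := Nat.choose_succ_right_eq m (h + 1)
      have e2 := Nat.choose_succ_right_eq m h
      rw [Nat.choose_succ_succ, Nat.add_sub_cancel]
      rcases Nat.lt_or_ge m (h + 1) with hm | hm
      · rcases Nat.lt_or_ge m h with hm' | hm'
        · simp [Nat.choose_eq_zero_of_lt hm', Nat.choose_eq_zero_of_lt hm,
            Nat.choose_eq_zero_of_lt (show m < h + 1 + 1 by omega)]
        · obtain rfl : m = h := by omega
          simp [Nat.choose_eq_zero_of_lt (show m < m + 1 + 1 by omega)]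
      · obtain ⟨d, rfl⟩ := Nat.exists_eq_add_of_le hm
        rw [show h + 1 + d - (h + 1) = d by omega] at e1
        rw [show h + 1 + d - h = d + 1 by omega] at e2
        zify at e1 e2 ⊢
        linear_combination ((h + 1 + d).factorial : ℤ) * e1 + ((h + 1 + d).factorial : ℤ) * e2

lemma lin_pathSum_card (n : ℕ) :
    pathSum linSteps nextHeight (fun _ _ => (1 : ℕ)) n 0 = Fintype.card (Equiv.Perm (Fin n)) := by
  simp [lin_pathSum_one, Fintype.card_perm]

lemma cyc_pathSum_card (n : ℕ) :
    pathSum cycSteps nextHeight (fun _ _ => (1 : ℕ)) n 0 = Fintype.card (Equiv.Perm (Fin n)) := by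
  have h1 : cycWeight (1 : ℕ) 1 1 1 1 = fun _ _ => 1 := by
    ext h ((_ | _) | (_ | _)) <;> simp [cycWeight]
  have h2 : linWeight (1 : ℕ) 1 1 1 1 = fun _ _ => 1 := by
    ext h ((_ | _) | (_ | _)) <;> simp [linWeight]
  rw [← lin_pathSum_card, ← h1, ← h2, cyc_pathSum_eq]
  simp

end Steps

/-! ### Extended permutations as pairs of mutually inverse functions on `ℕ` -/

/-- `F` and `G` restrict to mutually inverse permutations of `[1,n]`, and fix `0` and `n+1`. -/
structure IsExt (n : ℕ) (F G : ℕ → ℕ) : Prop where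
  zero : F 0 = 0
  zero' : G 0 = 0
  top : F (n + 1) = n + 1
  top' : G (n + 1) = n + 1
  pos : ∀ i, 1 ≤ i → i ≤ n → 1 ≤ F i
  pos' : ∀ i, 1 ≤ i → i ≤ n → 1 ≤ G i
  le : ∀ i, 1 ≤ i → i ≤ n → F i ≤ n
  le' : ∀ i, 1 ≤ i → i ≤ n → G i ≤ n
  left : ∀ i ≤ n + 1, G (F i) = i
  right : ∀ i ≤ n + 1, F (G i) = i

lemma IsExt.symm {n : ℕ} {F G : ℕ → ℕ} (h : IsExt n F G) : IsExt n G F :=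
  ⟨h.zero', h.zero, h.top', h.top, h.pos', h.pos, h.le', h.le, h.right, h.left⟩

lemma IsExt.inj {n : ℕ} {F G : ℕ → ℕ} (h : IsExt n F G) {i j : ℕ} (hi : i ≤ n + 1)
    (hj : j ≤ n + 1) (e : F i = F j) : i = j := by
  rw [← h.left i hi, ← h.left j hj, e]

lemma pextC_of_mem {n : ℕ} (σ : Equiv.Perm (Fin n)) {i : ℕ} (h1 : 1 ≤ i) (h2 : i ≤ n) :
    pextC n σ i = (σ ⟨i - 1, by omega⟩ : ℕ) + 1 := by
  simp [pextC, h1, h2]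

lemma pext_eq_pextC {n : ℕ} (σ : Equiv.Perm (Fin n)) {i : ℕ} (h1 : 1 ≤ i) (h2 : i ≤ n) :
    pext n σ i = pextC n σ i := by
  simp [pext, pextC, h1, h2]

lemma pextC_left {n : ℕ} (σ : Equiv.Perm (Fin n)) {i : ℕ} (h : i ≤ n + 1) :
    pextC n σ⁻¹ (pextC n σ i) = i := by
  rcases Nat.eq_zero_or_pos i with rfl | h1
  · simp [pextC]
  rcases Nat.lt_or_ge n i with h2 | h2
  · obtain rfl : i = n + 1 := by omega
    simp [pextC]
  rw [pextC_of_mem σ h1 h2, pextC_of_mem _ (by omega) (by omega)]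
  simp
  omega

lemma isExt_pextC {n : ℕ} (σ : Equiv.Perm (Fin n)) : IsExt n (pextC n σ) (pextC n σ⁻¹) where
  zero := by simp [pextC]
  zero' := by simp [pextC]
  top := by simp [pextC]
  top' := by simp [pextC]
  pos i h1 h2 := by rw [pextC_of_mem σ h1 h2]; omega
  pos' i h1 h2 := by rw [pextC_of_mem _ h1 h2]; omega
  le i h1 h2 := by rw [pextC_of_mem σ h1 h2]; omega
  le' i h1 h2 := by rw [pextC_of_mem _ h1 h2]; omega
  left i h := pextC_left σ h
  right i h := by simpa using pextC_left σ⁻¹ h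

lemma perm_ext_of_pextC {n : ℕ} {σ τ : Equiv.Perm (Fin n)}
    (h : ∀ i, 1 ≤ i → i ≤ n → pextC n σ i = pextC n τ i) : σ = τ := by
  ext i
  have := h (i + 1) (by omega) (by omega)
  rw [pextC_of_mem _ (by omega) (by omega), pextC_of_mem _ (by omega) (by omega)] at this
  simpa using this

section Ext

variable {n : ℕ} {F G F' G' : ℕ → ℕ}

lemma IsExt.sum_comp {M : Type*} [AddCommMonoid M] (h : IsExt n F G) (f : ℕ → M) :
    ∑ i ∈ Icc 1 n, f i = ∑ m ∈ range n, f (G (m + 1)) := by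
  have : ∑ i ∈ Icc 1 n, f i = ∑ v ∈ Icc 1 n, f (G v) := by
    refine Finset.sum_bij' (fun i _ => F i) (fun v _ => G v) ?_ ?_ ?_ ?_ ?_
    · intro i hi
      rw [mem_Icc] at hi ⊢
      exact ⟨h.pos i hi.1 hi.2, h.le i hi.1 hi.2⟩
    · intro i hi
      rw [mem_Icc] at hi ⊢
      exact ⟨h.pos' i hi.1 hi.2, h.le' i hi.1 hi.2⟩
    · intro i hi
      rw [mem_Icc] at hi
      exact h.left i (by omega)
    · intro i hi
      rw [mem_Icc] at hi
      exact h.right i (by omega)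
    · intro i hi
      rw [mem_Icc] at hi
      rw [h.left i (by omega)]
  rw [this, Finset.range_eq_Ico, Finset.sum_Ico_add' (fun i => f (G i)) 0 n 1]
  rfl

lemma sum_Icc_one {M : Type*} [AddCommMonoid M] (n : ℕ) (f : ℕ → M) :
    ∑ i ∈ Icc 1 n, f i = ∑ m ∈ range n, f (m + 1) := by
  rw [Finset.range_eq_Ico, Finset.sum_Ico_add' f 0 n 1]
  rfl

lemma card_filter_pairs_left (P : ℕ → ℕ → Prop) [∀ i j, Decidable (P i j)] :
    #{x ∈ pairs n | P x.1 x.2} = ∑ i ∈ Icc 1 n, #{j ∈ Icc 1 n | P i j} := by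
  simp only [pairs, Finset.card_filter, Finset.sum_product]

lemma card_filter_pairs_right (P : ℕ → ℕ → Prop) [∀ i j, Decidable (P i j)] :
    #{x ∈ pairs n | P x.1 x.2} = ∑ j ∈ Icc 1 n, #{i ∈ Icc 1 n | P i j} := by
  simp only [pairs, Finset.card_filter, Finset.sum_product_right]

/-! ### The linear history of a permutation -/

/-- The descents strictly straddling the value `v`, recorded by the position of their bottom. -/
def straddle (n : ℕ) (F : ℕ → ℕ) (v : ℕ) : Finset ℕ :=
  {i ∈ Icc 1 n | F i < v ∧ v < F (i - 1)}

/-- The descents from a value `> m` to a value `≤ m`, recorded by the position of their bottom. -/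
def openDesc (n : ℕ) (F : ℕ → ℕ) (m : ℕ) : Finset ℕ :=
  {i ∈ Icc 1 n | F i ≤ m ∧ m < F (i - 1)}

/-- The number of descents straddling the value `v` to its left. -/
def lesVal (n : ℕ) (F G : ℕ → ℕ) (v : ℕ) : ℕ := #{i ∈ straddle n F v | i < G v}

/-- The number of descents straddling the value `v` to its right. -/
def ressVal (n : ℕ) (F G : ℕ → ℕ) (v : ℕ) : ℕ := #{i ∈ straddle n F v | G v < i}

/-- The step of the linear history at the value `m + 1`. -/
def linCode (n : ℕ) (F G : ℕ → ℕ) (m : ℕ) : (ℕ ⊕ ℕ) ⊕ (ℕ ⊕ ℕ) :=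
  if F (G (m + 1) + 1) < m + 1 then
    if m + 1 < F (G (m + 1) - 1) then Sum.inr (Sum.inl (lesVal n F G (m + 1)))
    else Sum.inr (Sum.inr (lesVal n F G (m + 1)))
  else
    if m + 1 < F (G (m + 1) - 1) then Sum.inl (Sum.inl (lesVal n F G (m + 1)))
    else Sum.inl (Sum.inr (lesVal n F G (m + 1)))

lemma lesVal_add_ressVal (h : IsExt n F G) {v : ℕ} (hv : v ≤ n) :
    lesVal n F G v + ressVal n F G v = #(straddle n F v) := by
  rw [lesVal, ressVal, ← Finset.card_filter_add_card_filter_not (s := straddle n F v)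
    (fun i => i < G v)]
  congr 2
  refine Finset.filter_congr fun i hi => ?_
  have : i ≠ G v := by
    rintro rfl
    simp [straddle, h.right v (by omega)] at hi
  omega

lemma card_openDesc_left (h : IsExt n F G) {m : ℕ} (hm : m < n) :
    #(openDesc n F m) =
      #(straddle n F (m + 1)) + if F (G (m + 1) + 1) < m + 1 then 1 else 0 := by
  have hr := h.right (m + 1) (by omega)
  have hl : ∀ i ≤ n, F i = m + 1 → i = G (m + 1) := fun i hi e => by
    rw [← e, h.left i (by omega)]
  have hp := h.pos' (m + 1) (by omega) (by omega)
  have hq := h.le' (m + 1) (by omega) (by omega)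
  have ht := h.top
  split_ifs with hs
  · have : openDesc n F m = insert (G (m + 1) + 1) (straddle n F (m + 1)) := by
      ext i
      have := hl (i - 1)
      simp only [openDesc, straddle, mem_filter, mem_Icc, mem_insert]
      grind
    rw [this, Finset.card_insert_of_notMem]
    simp [straddle, hr]
  · rw [add_zero]
    congr 1
    ext i
    have := hl (i - 1)
    simp only [openDesc, straddle, mem_filter, mem_Icc]
    grind

lemma card_openDesc_right (h : IsExt n F G) {m : ℕ} (hm : m < n) :
    #(openDesc n F (m + 1)) =
      #(straddle n F (m + 1)) + if m + 1 < F (G (m + 1) - 1) then 1 else 0 := by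
  have hr := h.right (m + 1) (by omega)
  have hl : ∀ i ≤ n, F i = m + 1 → i = G (m + 1) := fun i hi e => by
    rw [← e, h.left i (by omega)]
  have hp := h.pos' (m + 1) (by omega) (by omega)
  have hq := h.le' (m + 1) (by omega) (by omega)
  split_ifs with hs
  · have : openDesc n F (m + 1) = insert (G (m + 1)) (straddle n F (m + 1)) := by
      ext i
      have := hl i
      simp only [openDesc, straddle, mem_filter, mem_Icc, mem_insert]
      grind
    rw [this, Finset.card_insert_of_notMem]
    simp [straddle, hr]
  · rw [add_zero]
    congr 1
    ext i
    have := hl i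
    simp only [openDesc, straddle, mem_filter, mem_Icc]
    grind

lemma card_openDesc_zero (h : IsExt n F G) : #(openDesc n F 0) = 0 := by
  rw [Finset.card_eq_zero, openDesc, Finset.filter_eq_empty_iff]
  intro i hi
  rw [mem_Icc] at hi
  have := h.pos i hi.1 hi.2
  omega

lemma card_openDesc_self (h : IsExt n F G) : #(openDesc n F n) = 0 := by
  rw [Finset.card_eq_zero, openDesc, Finset.filter_eq_empty_iff]
  intro i hi
  rw [mem_Icc] at hi
  have h0 := h.zero
  have := h.le (i - 1)
  grind

lemma linCode_mem (h : IsExt n F G) {m : ℕ} (hm : m < n) :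
    linCode n F G m ∈ linSteps #(openDesc n F m) := by
  have h1 := card_openDesc_left h hm
  have h2 := lesVal_add_ressVal h (show m + 1 ≤ n by omega)
  unfold linCode linSteps
  split_ifs at h1 ⊢ <;> simp <;> omega

lemma linCode_step (h : IsExt n F G) {m : ℕ} (hm : m < n) :
    #(openDesc n F (m + 1)) = nextHeight #(openDesc n F m) (linCode n F G m) := by
  have h1 := card_openDesc_left h hm
  have h2 := card_openDesc_right h hm
  unfold linCode nextHeight
  split_ifs at h1 h2 ⊢ <;> simp <;> omega

/-- Two words have the same restriction to the values `≤ m`. -/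
def LinAgree (F G F' G' : ℕ → ℕ) (m : ℕ) : Prop :=
  (∀ x y, 1 ≤ x → x ≤ m → 1 ≤ y → y ≤ m → (G x < G y ↔ G' x < G' y)) ∧
    ∀ x, 1 ≤ x → x ≤ m → (m < F (G x - 1) ↔ m < F' (G' x - 1))

lemma exists_desc_between (F : ℕ → ℕ) {v a b : ℕ} (hab : a < b) (ha : v ≤ F a)
    (hb : F b < v) : ∃ i, a < i ∧ i ≤ b ∧ F i < v ∧ v ≤ F (i - 1) := by
  induction b with
  | zero => omega
  | succ b ih =>
    rcases Nat.lt_or_ge (F b) v with hv | hv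
    · obtain ⟨i, h1, h2, h3⟩ := ih (by grind) hv
      exact ⟨i, h1, by omega, h3⟩
    · exact ⟨b + 1, hab, le_rfl, hb, by simpa using hv⟩

lemma lt_iff_card_le_lesVal (h : IsExt n F G) {m y : ℕ} (hm : m < n) (hy : 1 ≤ y)
    (hym : y ≤ m) :
    G y < G (m + 1) ↔
      #{x ∈ Icc 1 m | m < F (G x - 1) ∧ G x ≤ G y} ≤ lesVal n F G (m + 1) := by
  have hp := h.pos' (m + 1) (by omega) (by omega)
  have hq := h.le' (m + 1) (by omega) (by omega)
  have hr := h.right (m + 1) (by omega)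
  have hry := h.right y (by omega)
  have hqy := h.le' y (by omega) (by omega)
  have hc : #{x ∈ Icc 1 m | m < F (G x - 1) ∧ G x ≤ G y} =
      #{i ∈ Icc 1 n | F i ≤ m ∧ m < F (i - 1) ∧ i ≤ G y} := by
    refine Finset.card_bij' (fun x _ => G x) (fun i _ => F i) ?_ ?_ ?_ ?_
    · intro x hx
      simp only [mem_filter, mem_Icc] at hx ⊢
      have := h.right x (by omega)
      have := h.pos' x (by omega) (by omega)
      have := h.le' x (by omega) (by omega)
      grind
    · intro x hx
      simp only [mem_filter, mem_Icc] at hx ⊢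
      have := h.left x (by omega)
      have := h.pos x (by omega) (by omega)
      grind
    · intro x hx
      simp only [mem_filter, mem_Icc] at hx
      exact h.right x (by omega)
    · intro x hx
      simp only [mem_filter, mem_Icc] at hx
      exact h.left x (by omega)
  rw [hc, lesVal]
  have hl : ∀ i ≤ n, F i = m + 1 → i = G (m + 1) := fun i hi e => by
    rw [← e, h.left i (by omega)]
  constructor
  · intro hlt
    refine Finset.card_le_card fun i hi => ?_
    have := hl (i - 1)
    simp only [mem_filter, mem_Icc, straddle] at hi ⊢
    grind
  · intro hle
    by_contra hge
    have hne : G y ≠ G (m + 1) := fun e => by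
      have := h.symm.inj (by omega) (by omega) e
      omega
    obtain ⟨i, h1, h2, h3, h4⟩ := exists_desc_between F
      (show G (m + 1) < G y by omega) hr.ge (by omega)
    have : #(insert i {i ∈ straddle n F (m + 1) | i < G (m + 1)}) ≤
        #{i ∈ Icc 1 n | F i ≤ m ∧ m < F (i - 1) ∧ i ≤ G y} := by
      refine Finset.card_le_card fun j hj => ?_
      simp only [mem_filter, mem_Icc, straddle, mem_insert] at hj ⊢
      grind
    rw [Finset.card_insert_of_notMem (by simp; omega)] at this
    omega

/-- The letter before `x` is `v` if and only if the letter after `v` is smaller than `v`, and `x`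
is the first letter smaller than `v` to the right of `v`. -/
lemma pred_eq_iff (h : IsExt n F G) {m x : ℕ} (hm : m < n) (hx : 1 ≤ x) (hxm : x ≤ m) :
    F (G x - 1) = m + 1 ↔ F (G (m + 1) + 1) < m + 1 ∧ G (m + 1) < G x ∧
      ∀ y, 1 ≤ y → y ≤ m → ¬ (G (m + 1) < G y ∧ G y < G x) := by
  have hp := h.pos' (m + 1) (by omega) (by omega)
  have hq := h.le' (m + 1) (by omega) (by omega)
  have hr := h.right (m + 1) (by omega)
  have hpx := h.pos' x (by omega) (by omega)
  have hqx := h.le' x (by omega) (by omega)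
  have hrx := h.right x (by omega)
  have ht := h.top
  constructor
  · intro e
    have : G x - 1 = G (m + 1) := by rw [← e, h.left _ (by omega)]
    have e' : G x = G (m + 1) + 1 := by omega
    refine ⟨by rw [← e', hrx]; omega, by omega, fun y _ _ => by omega⟩
  · rintro ⟨h1, h2, h3⟩
    have hne : G (m + 1) ≠ n := fun e => by rw [e, ht] at h1; omega
    have h4 := h3 (F (G (m + 1) + 1)) (h.pos _ (by omega) (by omega)) (by omega)
    rw [h.left _ (by omega)] at h4
    have : G x - 1 = G (m + 1) := by omega
    rw [this, hr]

lemma linAgree_succ (h : IsExt n F G) (h' : IsExt n F' G') {m : ℕ} (hm : m < n)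
    (ha : LinAgree F G F' G' m) (hc : linCode n F G m = linCode n F' G' m) :
    LinAgree F G F' G' (m + 1) := by
  have hb : lesVal n F G (m + 1) = lesVal n F' G' (m + 1) ∧
      (F (G (m + 1) + 1) < m + 1 ↔ F' (G' (m + 1) + 1) < m + 1) ∧
      (m + 1 < F (G (m + 1) - 1) ↔ m + 1 < F' (G' (m + 1) - 1)) := by
    unfold linCode at hc
    split_ifs at hc <;> simp at hc <;> exact ⟨hc, by omega, by omega⟩
  obtain ⟨hb, hs, hu⟩ := hb
  have key : ∀ y, 1 ≤ y → y ≤ m → (G y < G (m + 1) ↔ G' y < G' (m + 1)) := by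
    intro y hy hym
    rw [lt_iff_card_le_lesVal h hm hy hym, lt_iff_card_le_lesVal h' hm hy hym, hb]
    suffices {x ∈ Icc 1 m | m < F (G x - 1) ∧ G x ≤ G y} =
      {x ∈ Icc 1 m | m < F' (G' x - 1) ∧ G' x ≤ G' y} by rw [this]
    refine Finset.filter_congr fun x hx => ?_
    rw [mem_Icc] at hx
    rw [ha.2 x hx.1 hx.2, ← not_lt, ← not_lt, ha.1 y x hy hym hx.1 hx.2]
  have key' : ∀ y, 1 ≤ y → y ≤ m → (G (m + 1) < G y ↔ G' (m + 1) < G' y) := by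
    intro y hy hym
    have := key y hy hym
    have h1 : G y ≠ G (m + 1) := fun e => by
      have := h.symm.inj (by omega) (by omega) e
      omega
    have h2 : G' y ≠ G' (m + 1) := fun e => by
      have := h'.symm.inj (by omega) (by omega) e
      omega
    omega
  have ho : ∀ x y, 1 ≤ x → x ≤ m + 1 → 1 ≤ y → y ≤ m + 1 → (G x < G y ↔ G' x < G' y) := by
    intro x y hx hxm hy hym
    rcases Nat.lt_or_ge m x with h1 | h1 <;> rcases Nat.lt_or_ge m y with h2 | h2
    · obtain rfl : x = m + 1 := by omega
      obtain rfl : y = m + 1 := by omega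
      simp
    · obtain rfl : x = m + 1 := by omega
      exact key' y hy h2
    · obtain rfl : y = m + 1 := by omega
      exact key x hx h1
    · exact ha.1 x y hx h1 hy h2
  refine ⟨ho, fun x hx hxm => ?_⟩
  rcases Nat.lt_or_ge m x with h1 | h1
  · obtain rfl : x = m + 1 := by omega
    exact hu
  · have e1 := ha.2 x hx h1
    have e2 : F (G x - 1) = m + 1 ↔ F' (G' x - 1) = m + 1 := by
      rw [pred_eq_iff h hm hx h1, pred_eq_iff h' hm hx h1, hs, key' x hx h1]
      refine and_congr_right fun _ => and_congr_right fun _ => forall_congr' fun y =>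
        forall_congr' fun hy => forall_congr' fun hym => ?_
      rw [key' y hy hym, ha.1 y x hy hym hx h1]
    omega

lemma linAgree_of_linCode (h : IsExt n F G) (h' : IsExt n F' G')
    (hc : ∀ m < n, linCode n F G m = linCode n F' G' m) {m : ℕ} (hm : m ≤ n) :
    LinAgree F G F' G' m := by
  induction m with
  | zero => exact ⟨fun _ _ _ _ _ _ => by omega, fun _ _ _ => by omega⟩
  | succ m ih => exact linAgree_succ h h' hm (ih (by omega)) (hc m hm)

end Ext

lemma linCode_injective {n : ℕ} {σ τ : Equiv.Perm (Fin n)}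
    (hc : ∀ m < n, linCode n (pextC n σ) (pextC n σ⁻¹) m =
      linCode n (pextC n τ) (pextC n τ⁻¹) m) : σ = τ := by
  have ha := (linAgree_of_linCode (isExt_pextC σ) (isExt_pextC τ) hc le_rfl).1
  have hlt : ∀ x y : Fin n, σ⁻¹ x < σ⁻¹ y ↔ τ⁻¹ x < τ⁻¹ y := by
    intro x y
    have := ha (x + 1) (y + 1) (by omega) (by omega) (by omega) (by omega)
    rw [pextC_of_mem _ (by omega) (by omega), pextC_of_mem _ (by omega) (by omega),
      pextC_of_mem _ (by omega) (by omega), pextC_of_mem _ (by omega) (by omega)] at this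
    simp only [Nat.add_sub_cancel, Fin.eta] at this
    rw [Fin.lt_def, Fin.lt_def]
    omega
  have hmono : StrictMono (τ⁻¹ * σ) := by
    intro x y hxy
    have := (hlt (σ x) (σ y)).1 (by simpa using hxy)
    simpa using this
  have hid : ∀ x, (τ⁻¹ * σ) x = x := fun x => by
    have := Subsingleton.elim (hmono.orderIsoOfSurjective _ (Equiv.surjective _))
      (OrderIso.refl (Fin n))
    exact congrArg (fun e : Fin n ≃o Fin n => e x) this
  ext x
  have := hid x
  rw [Equiv.Perm.mul_apply, Equiv.Perm.inv_eq_iff_eq] at this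
  rw [this]

/-! ### The linear statistics -/

/-- The number of double ascents which are not left-to-right maxima. -/
def notFmaxStat (n : ℕ) (σ : Equiv.Perm (Fin n)) : ℕ :=
  #{i ∈ Icc 1 n | (pextC n σ (i - 1) < pextC n σ i ∧ pextC n σ i < pextC n σ (i + 1)) ∧
    ¬ ∀ j ∈ Finset.Ico 1 i, pext n σ j < pext n σ i}

lemma daC_eq_add (n : ℕ) (σ : Equiv.Perm (Fin n)) :
    daC n σ = fmaxStat n σ + notFmaxStat n σ := by
  rw [daC, fmaxStat, notFmaxStat, ← Finset.card_filter_add_card_filter_not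
    (fun i => ∀ j ∈ Finset.Ico 1 i, pext n σ j < pext n σ i), Finset.filter_filter,
    Finset.filter_filter]
  simp only [and_assoc]
  congr!

section LinStats

variable {n : ℕ} (σ : Equiv.Perm (Fin n))

lemma lesStat_eq_sum :
    lesStat n σ = ∑ m ∈ range n, lesVal n (pextC n σ) (pextC n σ⁻¹) (m + 1) := by
  have h := isExt_pextC σ
  rw [lesStat, card_filter_pairs_right (fun i j => 2 ≤ i ∧ i < j ∧
    pext n σ i < pext n σ j ∧ pext n σ j < pext n σ (i - 1)), h.sum_comp]
  refine Finset.sum_congr rfl fun m hm => ?_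
  rw [mem_range] at hm
  rw [lesVal, straddle, Finset.filter_filter]
  congr 1
  refine Finset.filter_congr fun i hi => ?_
  rw [mem_Icc] at hi
  have h1 := h.pos' (m + 1) (by omega) (by omega)
  have h2 := h.le' (m + 1) (by omega) (by omega)
  have h3 := h.right (m + 1) (by omega)
  rw [pext_eq_pextC σ h1 h2, pext_eq_pextC σ hi.1 hi.2, h3]
  rcases Nat.lt_or_ge i 2 with hi2 | hi2
  · obtain rfl : i = 1 := by omega
    simp [h.zero]
  · rw [pext_eq_pextC σ (show 1 ≤ i - 1 by omega) (by omega)]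
    tauto

lemma ressStat_eq_sum :
    ressStat n σ = ∑ m ∈ range n, ressVal n (pextC n σ) (pextC n σ⁻¹) (m + 1) := by
  have h := isExt_pextC σ
  rw [ressStat, card_filter_pairs_left (fun i j => i < j ∧ j ≤ n - 1 ∧
    pext n σ (j + 1) < pext n σ i ∧ pext n σ i < pext n σ j), h.sum_comp]
  refine Finset.sum_congr rfl fun m hm => ?_
  rw [mem_range] at hm
  rw [ressVal, straddle, Finset.filter_filter]
  have h1 := h.pos' (m + 1) (by omega) (by omega)
  have h2 := h.le' (m + 1) (by omega) (by omega)
  have h3 := h.right (m + 1) (by omega)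
  refine Finset.card_bij' (fun j _ => j + 1) (fun i _ => i - 1) ?_ ?_ ?_ ?_
  · intro j hj
    simp only [mem_filter, mem_Icc] at hj ⊢
    obtain ⟨hj, hj1, hj2, hj3⟩ := hj
    rw [pext_eq_pextC σ h1 h2, pext_eq_pextC σ hj.1 hj.2,
      pext_eq_pextC σ (show 1 ≤ j + 1 by omega) (by omega), h3] at hj3
    rw [Nat.add_sub_cancel]
    omega
  · intro i hi
    simp only [mem_filter, mem_Icc] at hi ⊢
    have hne : i - 1 ≠ pextC n σ⁻¹ (m + 1) := fun e => by
      rw [e, h3] at hi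
      omega
    rw [pext_eq_pextC σ h1 h2, pext_eq_pextC σ (show 1 ≤ i - 1 by omega) (by omega),
      pext_eq_pextC σ (show 1 ≤ i - 1 + 1 by omega) (by omega), h3,
      show i - 1 + 1 = i by omega]
    omega
  · intro j _
    rfl
  · intro i hi
    simp only [mem_filter, mem_Icc] at hi
    omega

lemma foremax_iff {v : ℕ} (hv1 : 1 ≤ v) (hv : v ≤ n)
    (hp : pextC n σ (pextC n σ⁻¹ v - 1) < v) :
    (∀ j ∈ Finset.Ico 1 (pextC n σ⁻¹ v), pext n σ j < pext n σ (pextC n σ⁻¹ v)) ↔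
      lesVal n (pextC n σ) (pextC n σ⁻¹) v = 0 := by
  have h := isExt_pextC σ
  have h1 := h.pos' v hv1 hv
  have h2 := h.le' v hv1 hv
  have h3 := h.right v (by omega)
  rw [pext_eq_pextC σ h1 h2, h3, lesVal, Finset.card_eq_zero, Finset.filter_eq_empty_iff]
  simp only [straddle, mem_filter, mem_Icc, mem_Ico]
  constructor
  · rintro hf i ⟨⟨hi1, hi2⟩, hi3, hi4⟩ hi5
    rcases Nat.lt_or_ge i 2 with hi | hi
    · obtain rfl : i = 1 := by omega
      simp [h.zero] at hi4
    · have := hf (i - 1) ⟨by omega, by omega⟩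
      rw [pext_eq_pextC σ (by omega) (by omega)] at this
      omega
  · rintro hf j ⟨hj1, hj2⟩
    rw [pext_eq_pextC σ hj1 (by omega)]
    by_contra hj3
    have hne : j ≠ pextC n σ⁻¹ v - 1 := by
      rintro rfl
      omega
    obtain ⟨i, hi1, hi2, hi3, hi4⟩ := exists_desc_between (pextC n σ)
      (show j < pextC n σ⁻¹ v - 1 by omega) (not_lt.1 hj3) hp
    have hne' : v ≠ pextC n σ (i - 1) := fun e => by
      have := h.left (i - 1) (by omega)
      rw [← e] at this
      omega
    exact hf ⟨⟨by omega, by omega⟩, hi3, by omega⟩ (by omega)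

lemma prod_linWeight {R : Type*} [CommSemiring R] (p q t x y : R) :
    ∏ m ∈ range n, linWeight p q t x y #(openDesc n (pextC n σ) m)
        (linCode n (pextC n σ) (pextC n σ⁻¹) m) =
      p ^ ressStat n σ * q ^ lesStat n σ * t ^ valleyC n σ * x ^ fmaxStat n σ *
        y ^ notFmaxStat n σ := by
  have h := isExt_pextC σ
  rw [ressStat_eq_sum, lesStat_eq_sum, valleyC, fmaxStat, notFmaxStat, Finset.card_filter,
    Finset.card_filter, Finset.card_filter, h.sum_comp, h.sum_comp, h.sum_comp]
  simp only [← Finset.prod_pow_eq_pow_sum, ← Finset.prod_mul_distrib]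
  refine Finset.prod_congr rfl fun m hm => ?_
  rw [mem_range] at hm
  have h1 := h.pos' (m + 1) (by omega) (by omega)
  have h2 := h.le' (m + 1) (by omega) (by omega)
  have h3 := h.right (m + 1) (by omega)
  have e1 := card_openDesc_left h hm
  have e2 := lesVal_add_ressVal h (show m + 1 ≤ n by omega)
  have e3 := foremax_iff σ (show 1 ≤ m + 1 by omega) (show m + 1 ≤ n by omega)
  have n1 : pextC n σ (pextC n σ⁻¹ (m + 1) + 1) ≠ m + 1 := fun e => by
    have := h.inj (by omega) (by omega) (e.trans h3.symm)
    omega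
  have n2 : pextC n σ (pextC n σ⁻¹ (m + 1) - 1) ≠ m + 1 := fun e => by
    have := h.inj (by omega) (by omega) (e.trans h3.symm)
    omega
  rw [h3]
  unfold linCode linWeight
  generalize lesVal n (pextC n σ) (pextC n σ⁻¹) (m + 1) = b at *
  generalize ressVal n (pextC n σ) (pextC n σ⁻¹) (m + 1) = r at *
  by_cases hs : pextC n σ (pextC n σ⁻¹ (m + 1) + 1) < m + 1 <;>
    by_cases hu : m + 1 < pextC n σ (pextC n σ⁻¹ (m + 1) - 1)
  · have hr : #(openDesc n (pextC n σ) m) - 1 - b = r := by simp [hs] at e1; omega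
    simp [hs, hu, hs.not_gt, hu.not_gt, hr]
  · have hr : #(openDesc n (pextC n σ) m) - 1 - b = r := by simp [hs] at e1; omega
    simp [hs, hu, hs.not_gt, hr]
  · have hr : #(openDesc n (pextC n σ) m) - b = r := by simp [hs] at e1; omega
    have hs' : m + 1 < pextC n σ (pextC n σ⁻¹ (m + 1) + 1) := by omega
    simp [hs, hu, hu.not_gt, hs', hr]
    ring
  · have hr : #(openDesc n (pextC n σ) m) - b = r := by simp [hs] at e1; omega
    have hs' : m + 1 < pextC n σ (pextC n σ⁻¹ (m + 1) + 1) := by omega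
    have hu' : pextC n σ (pextC n σ⁻¹ (m + 1) - 1) < m + 1 := by omega
    have e4 := e3 hu'
    simp only [e4]
    by_cases hb : b = 0
    · subst hb
      rw [Nat.sub_zero] at hr
      simp [hs, hu, hs', hu', hr, mul_comm]
    · simp [hs, hu, hs', hu', hr, hb]
      ring

end LinStats

lemma sum_lin_eq_pathSum {R : Type*} [CommSemiring R] (n : ℕ) (p q t x y : R) :
    ∑ σ : Equiv.Perm (Fin n), p ^ ressStat n σ * q ^ lesStat n σ * t ^ valleyC n σ *
        x ^ fmaxStat n σ * y ^ notFmaxStat n σ =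
      pathSum linSteps nextHeight (linWeight p q t x y) n 0 := by
  rw [← sum_eq_pathSum (H := fun m σ => #(openDesc n (pextC n σ) m))
    (c := fun m σ => linCode n (pextC n σ) (pextC n σ⁻¹) m)
    (fun σ => card_openDesc_zero (isExt_pextC σ)) (fun σ => card_openDesc_self (isExt_pextC σ))
    (fun m hm σ => linCode_mem (isExt_pextC σ) hm) (fun m hm σ => linCode_step (isExt_pextC σ) hm)
    (fun σ τ h => linCode_injective h) (lin_pathSum_card n)]
  exact Finset.sum_congr rfl fun σ _ => (prod_linWeight σ p q t x y).symm

/-! ### The cyclic history of a permutation -/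

section Cyclic

variable {n : ℕ} {F G F' G' : ℕ → ℕ}

/-- The positions `i ≤ m` with a value `> m`. -/
def openExc (n : ℕ) (F : ℕ → ℕ) (m : ℕ) : Finset ℕ := {i ∈ Icc 1 n | i ≤ m ∧ m < F i}

/-- The positions `i > m` with a value `≤ m`. -/
def openDrop (n : ℕ) (F : ℕ → ℕ) (m : ℕ) : Finset ℕ := {i ∈ Icc 1 n | m < i ∧ F i ≤ m}

/-- The number of crossings of upper arcs whose arc closing first ends at `v`. -/
def crosUp (n : ℕ) (F G : ℕ → ℕ) (v : ℕ) : ℕ := #{j ∈ Icc 1 n | G v < j ∧ j ≤ v ∧ v < F j}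

/-- The number of nestings of upper arcs whose inner arc ends at `v`. -/
def nestUp (n : ℕ) (F G : ℕ → ℕ) (v : ℕ) : ℕ := #{i ∈ Icc 1 n | i < G v ∧ G v ≤ v ∧ v < F i}

/-- The number of crossings of lower arcs whose arc closing first ends at `v`. -/
def crosLow (n : ℕ) (F : ℕ → ℕ) (v : ℕ) : ℕ := #{i ∈ Icc 1 n | v < i ∧ F v < F i ∧ F i < v}

/-- The number of nestings of lower arcs whose inner arc ends at `v`. -/
def nestLow (n : ℕ) (F : ℕ → ℕ) (v : ℕ) : ℕ := #{i ∈ Icc 1 n | v < i ∧ F v < v ∧ F i < F v}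

/-- The step of the cyclic history at `m + 1`. -/
def cycCode (n : ℕ) (F G : ℕ → ℕ) (m : ℕ) : (Unit ⊕ ℕ) ⊕ (ℕ ⊕ (ℕ × ℕ)) :=
  if F (m + 1) < m + 1 then
    if m + 1 < G (m + 1) then Sum.inr (Sum.inl (crosLow n F (m + 1)))
    else Sum.inr (Sum.inr (crosUp n F G (m + 1), crosLow n F (m + 1)))
  else
    if m + 1 < G (m + 1) then Sum.inl (Sum.inl ())
    else Sum.inl (Sum.inr (crosUp n F G (m + 1)))

lemma crosUp_add_nestUp (h : IsExt n F G) {v : ℕ} (hv : v ≤ n) (hc : G v ≤ v) :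
    crosUp n F G v + nestUp n F G v = #(openExc n F v) := by
  have hr := h.right v (by omega)
  rw [crosUp, nestUp, ← Finset.card_filter_add_card_filter_not (s := openExc n F v)
    (fun i => G v < i), openExc, Finset.filter_filter, Finset.filter_filter]
  congr 2 <;> refine Finset.filter_congr fun i hi => ?_
  · tauto
  · have : v < F i → i ≠ G v := by
      rintro h1 rfl
      omega
    omega

lemma crosLow_add_nestLow (h : IsExt n F G) {m : ℕ} (hm : m < n) (hc : F (m + 1) < m + 1) :
    crosLow n F (m + 1) + nestLow n F (m + 1) + 1 = #(openDrop n F m) := by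
  have he : openDrop n F m = insert (m + 1) {i ∈ Icc 1 n | m + 1 < i ∧ F i < m + 1} := by
    ext i
    simp only [openDrop, mem_filter, mem_Icc, mem_insert]
    grind
  rw [he, Finset.card_insert_of_notMem (by simp), crosLow, nestLow,
    ← Finset.card_filter_add_card_filter_not (s := {i ∈ Icc 1 n | m + 1 < i ∧ F i < m + 1})
    (fun i => F (m + 1) < F i), Finset.filter_filter, Finset.filter_filter]
  congr 3 <;> refine Finset.filter_congr fun i hi => ?_
  · tauto
  · have : m + 1 < i → F i ≠ F (m + 1) := fun h1 e => by
      rw [mem_Icc] at hi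
      have := h.inj (by omega) (by omega) e
      omega
    omega

lemma card_openExc_succ (h : IsExt n F G) {m : ℕ} (hm : m < n) :
    #(openExc n F (m + 1)) + (if m + 1 < G (m + 1) then 0 else 1) =
      #(openExc n F m) + (if F (m + 1) < m + 1 then 0 else 1) := by
  have hr := h.right (m + 1) (by omega)
  have hp := h.pos' (m + 1) (by omega) (by omega)
  have hq := h.le' (m + 1) (by omega) (by omega)
  have hl : ∀ i ≤ n, F i = m + 1 → i = G (m + 1) := fun i hi e => by
    rw [← e, h.left i (by omega)]
  trans #{i ∈ Icc 1 n | i ≤ m + 1 ∧ m + 1 ≤ F i}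
  · split_ifs with hs
    · rw [add_zero, openExc]
      congr 1
      refine Finset.filter_congr fun i hi => ?_
      rw [mem_Icc] at hi
      have := hl i hi.2
      omega
    · rw [← Finset.card_insert_of_notMem (s := openExc n F (m + 1)) (a := G (m + 1))
        (by simp [openExc, hr])]
      congr 1
      ext i
      have := hl i
      simp only [openExc, mem_filter, mem_Icc, mem_insert]
      grind
  · split_ifs with hs
    · rw [add_zero, openExc]
      congr 1
      ext i
      simp only [mem_filter, mem_Icc]
      grind
    · rw [← Finset.card_insert_of_notMem (s := openExc n F m) (a := m + 1)
        (by simp [openExc])]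
      congr 1
      ext i
      simp only [openExc, mem_filter, mem_Icc, mem_insert]
      grind

lemma card_openDrop_succ (h : IsExt n F G) {m : ℕ} (hm : m < n) :
    #(openDrop n F (m + 1)) + (if F (m + 1) < m + 1 then 1 else 0) =
      #(openDrop n F m) + (if m + 1 < G (m + 1) then 1 else 0) := by
  have hr := h.right (m + 1) (by omega)
  have hp := h.pos' (m + 1) (by omega) (by omega)
  have hq := h.le' (m + 1) (by omega) (by omega)
  have hl : ∀ i ≤ n, F i = m + 1 → i = G (m + 1) := fun i hi e => by
    rw [← e, h.left i (by omega)]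
  have e1 : #(openDrop n F (m + 1)) = #{i ∈ Icc 1 n | m + 1 < i ∧ F i < m + 1} +
      (if m + 1 < G (m + 1) then 1 else 0) := by
    split_ifs with hs
    · rw [← Finset.card_insert_of_notMem (a := G (m + 1)) (by simp [hr])]
      congr 1
      ext i
      have := hl i
      simp only [openDrop, mem_filter, mem_Icc, mem_insert]
      grind
    · rw [add_zero]
      congr 1
      ext i
      have := hl i
      simp only [openDrop, mem_filter, mem_Icc]
      grind
  have e2 : #(openDrop n F m) = #{i ∈ Icc 1 n | m + 1 < i ∧ F i < m + 1} +
      (if F (m + 1) < m + 1 then 1 else 0) := by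
    split_ifs with hs
    · rw [← Finset.card_insert_of_notMem (a := m + 1) (by simp)]
      congr 1
      ext i
      simp only [openDrop, mem_filter, mem_Icc, mem_insert]
      grind
    · rw [add_zero]
      congr 1
      ext i
      simp only [openDrop, mem_filter, mem_Icc]
      grind
  omega

lemma card_openExc_zero : #(openExc n F 0) = 0 := by
  rw [Finset.card_eq_zero, openExc, Finset.filter_eq_empty_iff]
  intro i hi
  rw [mem_Icc] at hi
  omega

lemma card_openExc_self (h : IsExt n F G) : #(openExc n F n) = 0 := by
  rw [Finset.card_eq_zero, openExc, Finset.filter_eq_empty_iff]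
  intro i hi
  rw [mem_Icc] at hi
  have := h.le i hi.1 hi.2
  omega

lemma card_openDrop_eq (h : IsExt n F G) {m : ℕ} (hm : m ≤ n) :
    #(openDrop n F m) = #(openExc n F m) := by
  induction m with
  | zero =>
    rw [card_openExc_zero, Finset.card_eq_zero, openDrop, Finset.filter_eq_empty_iff]
    intro i hi
    rw [mem_Icc] at hi
    have := h.pos i hi.1 hi.2
    omega
  | succ m ih =>
    have h1 := ih (by omega)
    have h2 := card_openDrop_succ h hm
    have h3 := card_openExc_succ h hm
    split_ifs at h2 h3 <;> omega

lemma cycCode_mem (h : IsExt n F G) {m : ℕ} (hm : m < n) :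
    cycCode n F G m ∈ cycSteps #(openExc n F m) := by
  have h1 := card_openExc_succ h hm
  have h2 := crosUp_add_nestUp h (show m + 1 ≤ n by omega)
  have h3 := crosLow_add_nestLow h hm
  rw [card_openDrop_eq h hm.le] at h3
  unfold cycCode cycSteps
  split_ifs at h1 ⊢ <;> simp <;> omega

lemma cycCode_step (h : IsExt n F G) {m : ℕ} (hm : m < n) :
    #(openExc n F (m + 1)) = nextHeight #(openExc n F m) (cycCode n F G m) := by
  have h1 := card_openExc_succ h hm
  unfold cycCode nextHeight
  split_ifs at h1 ⊢ <;> simp <;> omega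

lemma eq_of_card_filter_eq {P : ℕ → Prop} [DecidablePred P] {k a b : ℕ} (hk : k ≤ n) (ha1 : 1 ≤ a) (ha : a ≤ k)
    (hb1 : 1 ≤ b) (hb : b ≤ k) (hPa : P a) (hPb : P b)
    (h : #{j ∈ Icc 1 n | a < j ∧ j ≤ k ∧ P j} = #{j ∈ Icc 1 n | b < j ∧ j ≤ k ∧ P j}) :
    a = b := by
  have key : ∀ a b, 1 ≤ b → b ≤ k → P b → a < b →
      #{j ∈ Icc 1 n | b < j ∧ j ≤ k ∧ P j} < #{j ∈ Icc 1 n | a < j ∧ j ≤ k ∧ P j} := by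
    intro a b hb1 hb hPb hab
    refine Finset.card_lt_card (Finset.ssubset_iff_of_subset ?_ |>.2 ⟨b, ?_, ?_⟩)
    · intro j
      simp only [mem_filter, mem_Icc]
      rintro ⟨h1, h2, h3⟩
      exact ⟨h1, by omega, h3⟩
    · simp only [mem_filter, mem_Icc]
      exact ⟨by omega, hab, hb, hPb⟩
    · simp
  rcases lt_trichotomy a b with hab | hab | hab
  · exact absurd h (key a b hb1 hb hPb hab).ne'
  · exact hab
  · exact absurd h (key b a ha1 ha hPa hab).ne

lemma crosUp_eq (h : IsExt n F G) (v : ℕ) :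
    crosUp n F G v = #{j ∈ Icc 1 n | G v < j ∧ j ≤ v ∧ v ≤ F j} := by
  rw [crosUp]
  congr 1
  refine Finset.filter_congr fun j hj => ?_
  rw [mem_Icc] at hj
  have : F j = v → j = G v := fun e => by rw [← e, h.left j (by omega)]
  omega

lemma crosLow_eq (h : IsExt n F G) (m : ℕ) :
    crosLow n F (m + 1) = #{j ∈ Icc 1 n | F (m + 1) < j ∧ j ≤ m ∧ m + 1 ≤ G j} := by
  refine Finset.card_bij' (fun i _ => F i) (fun j _ => G j) ?_ ?_ ?_ ?_
  · intro i hi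
    simp only [mem_filter, mem_Icc] at hi ⊢
    have := h.left i (by omega)
    have := h.pos i (by omega) (by omega)
    have := h.le i (by omega) (by omega)
    omega
  · intro j hj
    simp only [mem_filter, mem_Icc] at hj ⊢
    have h1 := h.right j (by omega)
    have := h.pos' j (by omega) (by omega)
    have := h.le' j (by omega) (by omega)
    have : G j ≠ m + 1 := fun e => by
      rw [e] at h1
      omega
    omega
  · intro i hi
    simp only [mem_filter, mem_Icc] at hi
    exact h.left i (by omega)
  · intro i hi
    simp only [mem_filter, mem_Icc] at hi
    exact h.right i (by omega)

/-- Two permutations have the same arcs within `[1,m]`. -/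
def CycAgree (F F' : ℕ → ℕ) (m : ℕ) : Prop :=
  ∀ i j, 1 ≤ i → i ≤ m → 1 ≤ j → j ≤ m → (F i = j ↔ F' i = j)

lemma CycAgree.lt_iff (h : IsExt n F G) (h' : IsExt n F' G') {m i : ℕ} (hm : m ≤ n)
    (ha : CycAgree F F' m) (hi : 1 ≤ i) (him : i ≤ m) : m < F i ↔ m < F' i := by
  have h1 := h.pos i hi (by omega)
  have h2 := h'.pos i hi (by omega)
  have h3 := ha i (F i) hi him h1
  have h4 := ha i (F' i) hi him h2
  grind

lemma CycAgree.symm (h : IsExt n F G) (h' : IsExt n F' G') {m : ℕ} (hm : m ≤ n)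
    (ha : CycAgree F F' m) : CycAgree G G' m := by
  have key : ∀ {F G : ℕ → ℕ}, IsExt n F G → ∀ i ≤ m, ∀ j ≤ m, (G i = j ↔ F j = i) := by
    intro F G h i hi j hj
    constructor
    · rintro rfl
      exact h.right i (by omega)
    · rintro rfl
      exact h.left j (by omega)
  intro i j hi him hj hjm
  rw [key h i him j hjm, key h' i him j hjm]
  exact ha j i hj hjm hi him

lemma cycAgree_succ (h : IsExt n F G) (h' : IsExt n F' G') {m : ℕ} (hm : m < n)
    (ha : CycAgree F F' m) (hc : cycCode n F G m = cycCode n F' G' m) :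
    CycAgree F F' (m + 1) := by
  have hb : (F (m + 1) < m + 1 ↔ F' (m + 1) < m + 1) ∧ (m + 1 < G (m + 1) ↔ m + 1 < G' (m + 1)) ∧
      (F (m + 1) < m + 1 → crosLow n F (m + 1) = crosLow n F' (m + 1)) ∧
      (G (m + 1) ≤ m + 1 → crosUp n F G (m + 1) = crosUp n F' G' (m + 1)) := by
    unfold cycCode at hc
    split_ifs at hc <;> simp at hc <;> refine ⟨by omega, by omega, by omega, by omega⟩
  obtain ⟨hb1, hb2, hb3, hb4⟩ := hb
  have hr := h.right (m + 1) (by omega)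
  have hr' := h'.right (m + 1) (by omega)
  have hge : ∀ j, 1 ≤ j → j ≤ m + 1 → (m + 1 ≤ F j ↔ m + 1 ≤ F' j) := by
    intro j hj hjm
    rcases Nat.lt_or_ge m j with h1 | h1
    · obtain rfl : j = m + 1 := by omega
      omega
    · exact ha.lt_iff h h' hm.le hj h1
  have hG : G (m + 1) ≤ m + 1 → G (m + 1) = G' (m + 1) := by
    intro hle
    have hle' : G' (m + 1) ≤ m + 1 := by omega
    have e := hb4 hle
    rw [crosUp_eq h, crosUp_eq h'] at e
    refine eq_of_card_filter_eq (P := fun j => m + 1 ≤ F' j) (k := m + 1) hm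
      (h.pos' _ (by omega) (by omega)) hle (h'.pos' _ (by omega) (by omega)) hle' ?_ hr'.ge ?_
    · exact (hge _ (h.pos' _ (by omega) (by omega)) hle).1 hr.ge
    · refine Eq.trans ?_ e
      congr 1
      refine Finset.filter_congr fun j hj => ?_
      rw [mem_Icc] at hj
      have := hge j hj.1
      tauto
  have hF : F (m + 1) < m + 1 → F (m + 1) = F' (m + 1) := by
    intro hlt
    have hlt' : F' (m + 1) < m + 1 := by omega
    have hge : ∀ j, 1 ≤ j → j ≤ m → (m + 1 ≤ G j ↔ m + 1 ≤ G' j) := fun j hj hjm =>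
      (ha.symm h h' hm.le).lt_iff h.symm h'.symm hm.le hj hjm
    have e := hb3 hlt
    rw [crosLow_eq h, crosLow_eq h'] at e
    have hp := h.pos (m + 1) (by omega) (by omega)
    refine eq_of_card_filter_eq (P := fun j => m + 1 ≤ G' j) (k := m) hm.le
      hp (by omega) (h'.pos _ (by omega) (by omega)) (by omega) ?_
      (h'.left _ (by omega)).ge ?_
    · exact (hge _ hp (by omega)).1 (h.left _ (by omega)).ge
    · refine Eq.trans ?_ e
      congr 1
      refine Finset.filter_congr fun j hj => ?_
      rw [mem_Icc] at hj
      have := hge j hj.1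
      tauto
  intro i j hi him hj hjm
  rcases Nat.lt_or_ge m j with h1 | h1
  · obtain rfl : j = m + 1 := by omega
    have e1 : F i = m + 1 ↔ i = G (m + 1) :=
      ⟨fun e => by rw [← e, h.left i (by omega)], fun e => by rw [e, hr]⟩
    have e2 : F' i = m + 1 ↔ i = G' (m + 1) :=
      ⟨fun e => by rw [← e, h'.left i (by omega)], fun e => by rw [e, hr']⟩
    omega
  · rcases Nat.lt_or_ge m i with h2 | h2
    · obtain rfl : i = m + 1 := by omega
      omega
    · exact ha i j hi h2 hj h1

lemma cycAgree_of_cycCode (h : IsExt n F G) (h' : IsExt n F' G')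
    (hc : ∀ m < n, cycCode n F G m = cycCode n F' G' m) {m : ℕ} (hm : m ≤ n) :
    CycAgree F F' m := by
  induction m with
  | zero => exact fun i j hi him hj hjm => by omega
  | succ m ih => exact cycAgree_succ h h' hm (ih (by omega)) (hc m hm)

end Cyclic

lemma cycCode_injective {n : ℕ} {σ τ : Equiv.Perm (Fin n)}
    (hc : ∀ m < n, cycCode n (pextC n σ) (pextC n σ⁻¹) m =
      cycCode n (pextC n τ) (pextC n τ⁻¹) m) : σ = τ := by
  have h := isExt_pextC σ
  have ha := cycAgree_of_cycCode h (isExt_pextC τ) hc le_rfl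
  exact perm_ext_of_pextC fun i h1 h2 =>
    ((ha i _ h1 h2 (h.pos i h1 h2) (h.le i h1 h2)).1 rfl).symm

/-! ### The cyclic statistics -/

section CycStats

variable {n : ℕ} (σ : Equiv.Perm (Fin n))

lemma card_filter_pairs_or (P Q : ℕ → ℕ → Prop) [∀ i j, Decidable (P i j)]
    [∀ i j, Decidable (Q i j)] (hPQ : ∀ i j, P i j → ¬ Q i j) :
    #{x ∈ pairs n | P x.1 x.2 ∨ Q x.1 x.2} =
      #{x ∈ pairs n | P x.1 x.2} + #{x ∈ pairs n | Q x.1 x.2} := by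
  rw [Finset.filter_or, Finset.card_union_of_disjoint]
  exact Finset.disjoint_filter.2 fun x _ => hPQ x.1 x.2

lemma crosStat_eq_sum :
    crosStat n σ = ∑ m ∈ range n, (crosUp n (pextC n σ) (pextC n σ⁻¹) (m + 1) +
      crosLow n (pextC n σ) (m + 1)) := by
  have h := isExt_pextC σ
  rw [crosStat, card_filter_pairs_or
    (fun i j => i < j ∧ j ≤ pext n σ i ∧ pext n σ i < pext n σ j)
    (fun i j => j < i ∧ pext n σ i < j ∧ pext n σ j < pext n σ i) (fun i j => by omega),
    card_filter_pairs_left (fun i j => i < j ∧ j ≤ pext n σ i ∧ pext n σ i < pext n σ j),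
    card_filter_pairs_right (fun i j => j < i ∧ pext n σ i < j ∧ pext n σ j < pext n σ i),
    h.sum_comp, sum_Icc_one, ← Finset.sum_add_distrib]
  refine Finset.sum_congr rfl fun m hm => ?_
  rw [mem_range] at hm
  have h1 := h.pos' (m + 1) (by omega) (by omega)
  have h2 := h.le' (m + 1) (by omega) (by omega)
  rw [pext_eq_pextC σ h1 h2, h.right (m + 1) (by omega),
    pext_eq_pextC σ (show 1 ≤ m + 1 by omega) (by omega), crosUp, crosLow]
  congr 2 <;> refine Finset.filter_congr fun i hi => ?_ <;>
    rw [mem_Icc] at hi <;> rw [pext_eq_pextC σ hi.1 hi.2]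
  omega

lemma nestStat_eq_sum :
    nestStat n σ = ∑ m ∈ range n, (nestUp n (pextC n σ) (pextC n σ⁻¹) (m + 1) +
      nestLow n (pextC n σ) (m + 1)) := by
  have h := isExt_pextC σ
  rw [nestStat, card_filter_pairs_or
    (fun i j => i < j ∧ j ≤ pext n σ j ∧ pext n σ j < pext n σ i)
    (fun i j => j < i ∧ pext n σ j < j ∧ pext n σ i < pext n σ j) (fun i j => by omega),
    card_filter_pairs_right (fun i j => i < j ∧ j ≤ pext n σ j ∧ pext n σ j < pext n σ i),
    card_filter_pairs_right (fun i j => j < i ∧ pext n σ j < j ∧ pext n σ i < pext n σ j),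
    h.sum_comp, sum_Icc_one, ← Finset.sum_add_distrib]
  refine Finset.sum_congr rfl fun m hm => ?_
  rw [mem_range] at hm
  have h1 := h.pos' (m + 1) (by omega) (by omega)
  have h2 := h.le' (m + 1) (by omega) (by omega)
  rw [pext_eq_pextC σ h1 h2, h.right (m + 1) (by omega),
    pext_eq_pextC σ (show 1 ≤ m + 1 by omega) (by omega), nestUp, nestLow]
  congr 2 <;> refine Finset.filter_congr fun i hi => ?_ <;>
    rw [mem_Icc] at hi <;> rw [pext_eq_pextC σ hi.1 hi.2]

lemma crosUp_eq_zero {F G : ℕ → ℕ} {v : ℕ} (hv : v < G v) : crosUp n F G v = 0 := by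
  rw [crosUp, Finset.card_eq_zero, Finset.filter_eq_empty_iff]
  omega

lemma nestUp_eq_zero {F G : ℕ → ℕ} {v : ℕ} (hv : v < G v) : nestUp n F G v = 0 := by
  rw [nestUp, Finset.card_eq_zero, Finset.filter_eq_empty_iff]
  omega

lemma crosLow_eq_zero {F : ℕ → ℕ} {v : ℕ} (hv : v ≤ F v) : crosLow n F v = 0 := by
  rw [crosLow, Finset.card_eq_zero, Finset.filter_eq_empty_iff]
  omega

lemma nestLow_eq_zero {F : ℕ → ℕ} {v : ℕ} (hv : v ≤ F v) : nestLow n F v = 0 := by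
  rw [nestLow, Finset.card_eq_zero, Finset.filter_eq_empty_iff]
  omega

lemma crosUp_eq_zero_iff {F G : ℕ → ℕ} (h : IsExt n F G) {v : ℕ} (hv1 : 1 ≤ v) (hv : v ≤ n)
    (hF : v ≤ F v) (hG : G v ≤ v) : crosUp n F G v = 0 ↔ F v = v := by
  have hl := h.left v (by omega)
  have hr := h.right v (by omega)
  rw [crosUp, Finset.card_eq_zero, Finset.filter_eq_empty_iff]
  constructor
  · intro hf
    by_contra hne
    refine hf (mem_Icc.2 ⟨hv1, hv⟩) ⟨lt_of_le_of_ne hG fun e => ?_, le_rfl, by omega⟩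
    rw [e] at hr
    exact hne hr
  · intro e i hi
    rw [e] at hl
    omega

lemma prod_cycWeight {R : Type*} [CommSemiring R] (p q t x y : R) :
    ∏ m ∈ range n, cycWeight p q t x y #(openExc n (pextC n σ) m)
        (cycCode n (pextC n σ) (pextC n σ⁻¹) m) =
      p ^ nestStat n σ * q ^ crosStat n σ * t ^ cvalleyStat n σ * x ^ fixStat n σ *
        y ^ cdaStat n σ := by
  have h := isExt_pextC σ
  rw [nestStat_eq_sum, crosStat_eq_sum, cvalleyStat, fixStat, cdaStat, Finset.card_filter,
    Finset.card_filter, Finset.card_filter, sum_Icc_one, sum_Icc_one, sum_Icc_one]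
  simp only [← Finset.prod_pow_eq_pow_sum, ← Finset.prod_mul_distrib]
  refine Finset.prod_congr rfl fun m hm => ?_
  rw [mem_range] at hm
  have hv : m + 1 ≤ n := hm
  rw [pext_eq_pextC σ (by omega) hv, pext_eq_pextC σ⁻¹ (by omega) hv]
  have hl := h.left (m + 1) (by omega)
  have hr := h.right (m + 1) (by omega)
  have e1 := crosUp_add_nestUp h hv
  have e2 := crosLow_add_nestLow h hm
  rw [card_openDrop_eq h hm.le] at e2
  have e3 := card_openExc_succ h hm
  have z1 := crosUp_eq_zero (n := n) (F := pextC n σ) (G := pextC n σ⁻¹) (v := m + 1)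
  have z2 := nestUp_eq_zero (n := n) (F := pextC n σ) (G := pextC n σ⁻¹) (v := m + 1)
  have z3 := crosLow_eq_zero (n := n) (F := pextC n σ) (v := m + 1)
  have z4 := nestLow_eq_zero (n := n) (F := pextC n σ) (v := m + 1)
  have e4 := crosUp_eq_zero_iff h (show 1 ≤ m + 1 by omega) hv
  have e5 : pextC n σ (m + 1) = m + 1 ↔ pextC n σ⁻¹ (m + 1) = m + 1 :=
    ⟨fun e => by rwa [e] at hl, fun e => by rwa [e] at hr⟩
  unfold cycCode cycWeight
  generalize crosUp n (pextC n σ) (pextC n σ⁻¹) (m + 1) = a at *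
  generalize nestUp n (pextC n σ) (pextC n σ⁻¹) (m + 1) = b at *
  generalize crosLow n (pextC n σ) (m + 1) = c at *
  generalize nestLow n (pextC n σ) (m + 1) = d at *
  generalize #(openExc n (pextC n σ) m) = k at *
  generalize #(openExc n (pextC n σ) (m + 1)) = k' at *
  generalize pextC n σ (m + 1) = f at *
  generalize pextC n σ⁻¹ (m + 1) = g at *
  clear h hl hr
  by_cases hs : f < m + 1 <;> by_cases hu : m + 1 < g
  · simp only [hs, hu, if_true] at e3
    obtain rfl := z1 hu
    obtain rfl := z2 hu
    obtain rfl : k - 1 - c = d := by omega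
    simp [hs, hu, hs.not_gt, hu.not_gt, hs.ne]
  · simp only [hs, hu, if_true, if_false] at e3
    have r1 : k - 1 - c = d := by omega
    have r2 : k - 1 - a = b := by omega
    simp [hs, hu, hs.not_gt, hs.ne, r1, r2]
    ring
  · obtain rfl := z1 hu
    obtain rfl := z2 hu
    obtain rfl := z3 (by omega)
    obtain rfl := z4 (by omega)
    have hf : m + 1 < f := by omega
    simp [hs, hu, hu.not_gt, hf, hf.ne']
  · obtain rfl := z3 (by omega)
    obtain rfl := z4 (by omega)
    simp only [hs, hu, if_false] at e3
    have r : k - a = b := by omega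
    by_cases hf : f = m + 1
    · obtain rfl := (e4 (by omega) (by omega)).2 hf
      rw [Nat.sub_zero] at r
      simp [hf, hu, r, mul_comm]
    · have ha : a ≠ 0 := fun e => hf ((e4 (by omega) (by omega)).1 e)
      have hf' : m + 1 < f := by omega
      have hg : g < m + 1 := by omega
      simp [hs, hf, hu, hf', hg, r, ha]
      ring

end CycStats

lemma sum_cyc_eq_pathSum {R : Type*} [CommSemiring R] (n : ℕ) (p q t x y : R) :
    ∑ σ : Equiv.Perm (Fin n), p ^ nestStat n σ * q ^ crosStat n σ * t ^ cvalleyStat n σ *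
        x ^ fixStat n σ * y ^ cdaStat n σ =
      pathSum cycSteps nextHeight (cycWeight p q t x y) n 0 := by
  rw [← sum_eq_pathSum (H := fun m σ => #(openExc n (pextC n σ) m))
    (c := fun m σ => cycCode n (pextC n σ) (pextC n σ⁻¹) m)
    (fun σ => card_openExc_zero) (fun σ => card_openExc_self (isExt_pextC σ))
    (fun m hm σ => cycCode_mem (isExt_pextC σ) hm) (fun m hm σ => cycCode_step (isExt_pextC σ) hm)
    (fun σ τ h => cycCode_injective h) (cyc_pathSum_card n)]
  exact Finset.sum_congr rfl fun σ _ => (prod_cycWeight σ p q t x y).symm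

/-- The joint distributions of the cyclic and of the linear statistics coincide. -/
lemma sum_cyc_eq_sum_lin {R : Type*} [CommSemiring R] (n : ℕ) (p q t x y : R) :
    ∑ σ : Equiv.Perm (Fin n), p ^ nestStat n σ * q ^ crosStat n σ * t ^ cvalleyStat n σ *
        x ^ fixStat n σ * y ^ cdaStat n σ =
      ∑ σ : Equiv.Perm (Fin n), p ^ ressStat n σ * q ^ lesStat n σ * t ^ valleyC n σ *
        x ^ fmaxStat n σ * y ^ notFmaxStat n σ := by
  rw [sum_cyc_eq_pathSum, sum_lin_eq_pathSum, cyc_pathSum_eq]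
  simp

/-- Extraction of a coefficient of a generating polynomial in three statistics. -/
lemma coeff_coeff_sum {A Ω : Type*} [CommSemiring A] [Fintype Ω] (w : Ω → A) (a b c : Ω → ℕ)
    (k j : ℕ) :
    ((∑ ω, Polynomial.C (Polynomial.C (w ω)) * (Polynomial.X : Polynomial (Polynomial A)) ^ a ω *
        Polynomial.C Polynomial.X ^ b ω * 0 ^ c ω).coeff k).coeff j =
      ∑ ω with a ω = k ∧ b ω = j ∧ c ω = 0, w ω := by
  rw [Finset.sum_filter, Polynomial.finsetSum_coeff, Polynomial.finsetSum_coeff]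
  refine Finset.sum_congr rfl fun ω _ => ?_
  by_cases hc : c ω = 0
  · rw [hc, pow_zero, mul_one, mul_right_comm, ← Polynomial.C_pow, ← Polynomial.C_mul,
      Polynomial.coeff_C_mul_X_pow]
    by_cases ha : k = a ω
    · simp [ha, eq_comm]
    · simp [ha, Ne.symm ha]
  · simp [hc]

open MvPolynomial in
theorem statement6 (n k j : ℕ) (hn : 1 ≤ n) :
    (∑ σ ∈ Finset.univ.filter
        (fun σ : Equiv.Perm (Fin n) =>
          cvalleyStat n σ = k ∧ fixStat n σ = j ∧ cdaStat n σ = 0),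
      (X 0 : MvPolynomial (Fin 2) ℤ) ^ nestStat n σ * X 1 ^ crosStat n σ) =
    ∑ σ ∈ Finset.univ.filter
        (fun σ : Equiv.Perm (Fin n) =>
          valleyC n σ = k ∧ daC n σ = j ∧ fmaxStat n σ = j),
      (X 0 : MvPolynomial (Fin 2) ℤ) ^ ressStat n σ * X 1 ^ lesStat n σ := by
  have hlin : ∀ σ : Equiv.Perm (Fin n), (valleyC n σ = k ∧ daC n σ = j ∧ fmaxStat n σ = j) ↔
      (valleyC n σ = k ∧ fmaxStat n σ = j ∧ notFmaxStat n σ = 0) := fun σ => by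
    have := daC_eq_add n σ
    omega
  have key := sum_cyc_eq_sum_lin n
    (Polynomial.C (Polynomial.C (X 0 : MvPolynomial (Fin 2) ℤ)))
    (Polynomial.C (Polynomial.C (X 1))) Polynomial.X (Polynomial.C Polynomial.X) 0
  simp only [← Polynomial.C_pow (a := (X _ : MvPolynomial (Fin 2) ℤ)),
    ← Polynomial.C_pow (a := Polynomial.C (_ : MvPolynomial (Fin 2) ℤ)),
    ← Polynomial.C_mul] at key
  have := congrArg (fun P => (P.coeff k).coeff j) key
  simp only [coeff_coeff_sum] at this
  simp only [hlin]
  convert this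

end SZpaper
end
end

section
/- For every integer n ≥ 1, the following identity holds in ℤ[p,q,t,u,v,w,y]: Σ_{σ∈S_n} p^{nest σ} q^{cros σ} t^{drop σ} u^{cda σ} v^{cdd σ} w^{cvalley σ} y^{fix σ} = Σ_{j=0}^{n} y^j · Σ_{k=0}^{⌊(n−j)/2⌋} b_{n,k,j}(p,q) · (tw)^k · (qu+tv)^{n−j−2k}. -/
open scoped Classical
open Finset

noncomputable section

namespace SZpaper

open MvPolynomial in
/-- `b_{n,k,j}(p,q)` (with `p = X 0`, `q = X 1`), as an element of
`ℤ[p,q,t,u,v,w,y]`. -/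
def bPoly7 (n k j : ℕ) : MvPolynomial (Fin 7) ℤ :=
  ∑ σ ∈ Finset.univ.filter
      (fun σ : Equiv.Perm (Fin n) =>
        cvalleyStat n σ = k ∧ fixStat n σ = j ∧ cdaStat n σ = 0),
    X 0 ^ nestStat n σ * X 1 ^ crosStat n σ

section Matchings

variable {α R : Type*} [LinearOrder α] [CommRing R] (p q : R)

/-- The contribution of a pair of arcs, the first one joining `a` to its closer `c`, the second one
with opener `d` and a closer greater than `c`. If `b` holds, `d = c` counts as a crossing. -/
def closeWt (b : Prop) (c a d : α) : R :=
  if d < a then p else if d < c ∨ (b ∧ d = c) then q else 1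

/-- The weight of the arc diagram joining every closer `c ∈ t` to the opener `g c`. -/
def matchWt (b : Prop) (t : Finset α) (g : α → α) : R :=
  ∏ c ∈ t, ∏ d ∈ t with c < d, closeWt p q b c (g c) (g d)

/-- The arc diagrams with set of openers `s` and set of closers `t`. -/
def matchings [Fintype α] (s t : Finset α) : Finset (α → α) :=
  univ.filter fun g => (∀ x ∈ t, g x < x) ∧ Set.InjOn g t ∧ t.image g = s ∧ ∀ x ∉ t, g x = x

/-- The `(p,q)`-integer, written with increasing powers of `p`. -/
def openInt (m : ℕ) : R := ∑ j ∈ range m, p ^ j * q ^ (m - 1 - j)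

lemma openInt_zero : openInt p q 0 = 0 := by simp [openInt]

lemma openInt_succ (m : ℕ) : openInt p q (m + 1) = q * openInt p q m + p ^ m := by
  unfold openInt
  rw [Finset.sum_range_succ, Finset.mul_sum]
  congr 1
  · refine Finset.sum_congr rfl fun j hj => ?_
    have hj := Finset.mem_range.1 hj
    rw [show m + 1 - 1 - j = (m - 1 - j) + 1 by omega, pow_succ]
    ring
  · simp

lemma sum_pow_card_lt (s : Finset α) :
    ∑ a ∈ s, p ^ #{b ∈ s | b < a} * q ^ #{b ∈ s | a < b} = openInt p q #s := by
  induction s using Finset.induction_on_max with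
  | empty => simp [openInt_zero]
  | insert m s hm ih =>
    have hms : m ∉ s := fun h => lt_irrefl _ (hm m h)
    rw [Finset.sum_insert hms, Finset.card_insert_of_notMem hms, openInt_succ, ← ih, add_comm,
      Finset.mul_sum]
    congr 1
    · refine Finset.sum_congr rfl fun a ha => ?_
      rw [Finset.filter_insert, Finset.filter_insert, if_neg (not_lt.2 (hm a ha).le),
        if_pos (hm a ha), Finset.card_insert_of_notMem (by simp [hms])]
      ring
    · rw [Finset.filter_insert, Finset.filter_insert, if_neg (lt_irrefl _), if_neg (lt_irrefl _),
        Finset.filter_true_of_mem hm, Finset.filter_false_of_mem fun x hx => not_lt.2 (hm x hx).le]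
      simp

lemma sum_prod_closeWt (b : Prop) (s : Finset α) (c : α) :
    ∑ a ∈ s with a < c, ∏ d ∈ s.erase a, closeWt p q b c a d =
      (if b ∧ c ∈ s then q else 1) * openInt p q #{x ∈ s | x < c} := by
  rw [← sum_pow_card_lt, Finset.mul_sum]
  refine Finset.sum_congr rfl fun a ha => ?_
  obtain ⟨has, hac⟩ := Finset.mem_filter.1 ha
  have key : ∏ d ∈ s.erase a, closeWt p q b c a d =
      ∏ d ∈ s, (if d = c then if b then q else 1 else 1) *
        ((if d < c ∧ d < a then p else 1) * (if d < c ∧ a < d then q else 1)) := by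
    rw [← Finset.mul_prod_erase s _ has]
    simp only [hac.ne, if_false, lt_irrefl, and_false, one_mul]
    refine Finset.prod_congr rfl fun d hd => ?_
    have hda : d ≠ a := Finset.ne_of_mem_erase hd
    unfold closeWt
    rcases lt_trichotomy d a with h | h | h
    · simp [h, h.trans hac, (h.trans hac).ne, h.le]
    · exact absurd h hda
    · rcases lt_trichotomy d c with h' | h' | h'
      · simp [h, h', h'.ne, not_lt.2 h.le]
      · subst h'; simp [not_lt.2 h.le]
      · simp [not_lt.2 h.le, not_lt.2 h'.le, h'.ne']
  rw [key, Finset.prod_mul_distrib, Finset.prod_mul_distrib, Finset.prod_ite_eq',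
    Finset.filter_filter, Finset.filter_filter]
  congr 1
  · by_cases hb : b <;> by_cases hc : c ∈ s <;> simp [hb, hc]
  · simp [Finset.prod_ite]

lemma matchWt_congr (b : Prop) {t : Finset α} {g g' : α → α} (h : ∀ x ∈ t, g x = g' x) :
    matchWt p q b t g = matchWt p q b t g' := by
  refine Finset.prod_congr rfl fun c hc => Finset.prod_congr rfl fun d hd => ?_
  rw [h c hc, h d (Finset.mem_filter.1 hd).1]

lemma matchWt_insert (b : Prop) {t : Finset α} {c : α} (hc : ∀ x ∈ t, c < x) (g : α → α) :
    matchWt p q b (insert c t) g =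
      (∏ d ∈ t, closeWt p q b c (g c) (g d)) * matchWt p q b t g := by
  have hct : c ∉ t := fun h => lt_irrefl _ (hc c h)
  unfold matchWt
  rw [Finset.prod_insert hct, Finset.filter_insert, if_neg (lt_irrefl _),
    Finset.filter_true_of_mem hc]
  congr 1
  refine Finset.prod_congr rfl fun x hx => ?_
  rw [Finset.filter_insert, if_neg (not_lt.2 (hc x hx).le)]

variable [Fintype α]

lemma mem_matchings {s t : Finset α} {g : α → α} : g ∈ matchings s t ↔
    (∀ x ∈ t, g x < x) ∧ Set.InjOn g t ∧ t.image g = s ∧ ∀ x ∉ t, g x = x := by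
  simp [matchings]

lemma card_eq_of_mem_matchings {s t : Finset α} {g : α → α} (h : g ∈ matchings s t) :
    #s = #t := by
  obtain ⟨-, h2, h3, -⟩ := mem_matchings.1 h
  rw [← h3, Finset.card_image_of_injOn h2]

lemma update_mem_matchings {s t : Finset α} {c : α} (hct : c ∉ t) {g : α → α}
    (hg : g ∈ matchings s (insert c t)) :
    Function.update g c c ∈ matchings (s.erase (g c)) t := by
  obtain ⟨h1, h2, h3, h4⟩ := mem_matchings.1 hg
  have hne : ∀ x ∈ t, x ≠ c := fun x hx h => hct (h ▸ hx)
  have heq : ∀ x ∈ t, Function.update g c c x = g x := fun x hx =>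
    Function.update_of_ne (hne x hx) _ _
  refine mem_matchings.2 ⟨fun x hx => ?_, fun x hx y hy hxy => ?_, ?_, fun x hx => ?_⟩
  · rw [heq x hx]; exact h1 x (by simp [hx])
  · rw [heq x hx, heq y hy] at hxy
    exact h2 (by simp [Finset.mem_coe.1 hx]) (by simp [Finset.mem_coe.1 hy]) hxy
  · rw [Finset.image_congr (fun x hx => heq x hx), ← h3, Finset.image_insert,
      Finset.erase_insert]
    intro hmem
    obtain ⟨x, hx, hxc⟩ := Finset.mem_image.1 hmem
    exact hne x hx (h2 (by simp [hx]) (by simp) hxc)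
  · by_cases hxc : x = c
    · simp [hxc]
    · rw [Function.update_of_ne hxc]; exact h4 x (by simp [hxc, hx])

lemma update_mem_matchings_insert {s t : Finset α} {a c : α} (hct : c ∉ t) (has : a ∈ s)
    (hac : a < c) {g : α → α} (hg : g ∈ matchings (s.erase a) t) :
    Function.update g c a ∈ matchings s (insert c t) := by
  obtain ⟨h1, h2, h3, h4⟩ := mem_matchings.1 hg
  have hne : ∀ x ∈ t, x ≠ c := fun x hx h => hct (h ▸ hx)
  have heq : ∀ x ∈ t, Function.update g c a x = g x := fun x hx =>
    Function.update_of_ne (hne x hx) _ _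
  have himg : ∀ x ∈ t, g x ≠ a := fun x hx h => by
    have := Finset.mem_image_of_mem g hx
    rw [h3, h] at this
    simp at this
  refine mem_matchings.2 ⟨fun x hx => ?_, ?_, ?_, fun x hx => ?_⟩
  · rcases Finset.mem_insert.1 hx with rfl | hx
    · simpa using hac
    · rw [heq x hx]; exact h1 x hx
  · rw [Finset.coe_insert, Set.injOn_insert (by simpa using hct)]
    refine ⟨fun x hx y hy hxy => ?_, ?_⟩
    · rw [heq x hx, heq y hy] at hxy
      exact h2 hx hy hxy
    · rintro ⟨x, hx, hxa⟩
      rw [heq x hx, Function.update_self] at hxa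
      exact himg x hx hxa
  · rw [Finset.image_insert, Finset.image_congr (fun x hx => heq x hx), h3,
      Function.update_self, Finset.insert_erase has]
  · rw [Finset.mem_insert, not_or] at hx
    rw [Function.update_of_ne hx.1]
    exact h4 x hx.2

lemma sum_matchings_insert (b : Prop) (s : Finset α) {t : Finset α} {c : α}
    (hc : ∀ x ∈ t, c < x) :
    ∑ g ∈ matchings s (insert c t), matchWt p q b (insert c t) g =
      ∑ a ∈ s with a < c, (∏ d ∈ s.erase a, closeWt p q b c a d) *
        ∑ g ∈ matchings (s.erase a) t, matchWt p q b t g := by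
  have hct : c ∉ t := fun h => lt_irrefl _ (hc c h)
  simp_rw [Finset.mul_sum]
  rw [Finset.sum_sigma']
  refine Finset.sum_bij' (fun g _ => ⟨g c, Function.update g c c⟩)
    (fun x _ => Function.update x.2 c x.1) ?_ ?_ ?_ ?_ ?_
  · intro g hg
    obtain ⟨h1, h2, h3, h4⟩ := mem_matchings.1 hg
    refine Finset.mem_sigma.2 ⟨Finset.mem_filter.2 ⟨?_, h1 c (by simp)⟩,
      update_mem_matchings hct hg⟩
    rw [← h3]
    exact Finset.mem_image_of_mem g (by simp)
  · rintro ⟨a, g⟩ hx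
    obtain ⟨ha, hg⟩ := Finset.mem_sigma.1 hx
    obtain ⟨has, hac⟩ := Finset.mem_filter.1 ha
    exact update_mem_matchings_insert hct has hac hg
  · intro g hg
    simp
  · rintro ⟨a, g⟩ hx
    obtain ⟨ha, hg⟩ := Finset.mem_sigma.1 hx
    have hgc : g c = c := (mem_matchings.1 hg).2.2.2 c hct
    simp only [Function.update_self, Function.update_idem]
    congr 1
    conv_rhs => rw [← Function.update_eq_self c g, hgc]
  · intro g hg
    have hu := update_mem_matchings hct hg
    obtain ⟨h1, h2, h3, h4⟩ := mem_matchings.1 hu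
    have heq : ∀ x ∈ t, Function.update g c c x = g x := fun x hx =>
      Function.update_of_ne (ne_of_mem_of_not_mem hx hct) _ _
    rw [matchWt_insert p q b hc, ← h3, Finset.prod_image h2,
      matchWt_congr p q b (fun x hx => heq x hx)]
    congr 1
    exact Finset.prod_congr rfl fun d hd => by rw [heq d hd]

/-- The generating function of arc diagrams with given openers and closers is a product. -/
theorem sum_matchings (b : Prop) (s t : Finset α) (hst : #s = #t) :
    ∑ g ∈ matchings s t, matchWt p q b t g =
      ∏ c ∈ t, (if b ∧ c ∈ s then q else 1) *
        openInt p q (#{x ∈ s | x < c} - #{x ∈ t | x < c}) := by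
  induction t using Finset.induction_on_min generalizing s with
  | empty =>
    have hs : s = ∅ := by simpa using hst
    have : matchings s (∅ : Finset α) = {id} := by
      ext g
      simp [mem_matchings, hs, funext_iff]
    rw [this]
    simp [matchWt]
  | insert c t hc ih =>
    have hct : c ∉ t := fun h => lt_irrefl _ (hc c h)
    rw [sum_matchings_insert p q b s hc, Finset.prod_insert hct,
      Finset.filter_insert, if_neg (lt_irrefl _),
      Finset.filter_false_of_mem (fun x hx => not_lt.2 (hc x hx).le), Finset.card_empty,
      Nat.sub_zero, ← sum_prod_closeWt, Finset.sum_mul]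
    refine Finset.sum_congr rfl fun a ha => ?_
    obtain ⟨has, hac⟩ := Finset.mem_filter.1 ha
    rw [ih (s.erase a) (by
      rw [Finset.card_erase_of_mem has, hst, Finset.card_insert_of_notMem hct]; simp)]
    congr 1
    refine Finset.prod_congr rfl fun x hx => ?_
    have hax : a < x := hac.trans (hc x hx)
    have h1 : #{y ∈ s.erase a | y < x} = #{y ∈ s | y < x} - 1 := by
      rw [Finset.filter_erase, Finset.card_erase_of_mem (by simp [has, hax])]
    have h2 : #{y ∈ insert c t | y < x} = #{y ∈ t | y < x} + 1 := by
      rw [Finset.filter_insert, if_pos (hc x hx), Finset.card_insert_of_notMem (by simp [hct])]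
    rw [h1, h2, Nat.sub_sub, add_comm 1]
    simp [hax.ne']

end Matchings

section Permutations

variable {α R : Type*} [LinearOrder α] [Fintype α] [CommRing R] (p q : R)

/-- `σ` has excedance openers `s` and closers `t`, drop openers `s'` and closers `t'`. -/
structure HasArcs (σ : Equiv.Perm α) (s t s' t' : Finset α) : Prop where
  exc : ∀ x, x ∈ s ↔ x < σ x
  excClose : ∀ x, x ∈ t ↔ σ⁻¹ x < x
  dropOpen : ∀ x, x ∈ s' ↔ x < σ⁻¹ x
  drop : ∀ x, x ∈ t' ↔ σ x < x

lemma HasArcs.restrict_inv_mem {σ : Equiv.Perm α} {s t s' t' : Finset α}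
    (h : HasArcs σ s t s' t') : (fun x => if x ∈ t then σ⁻¹ x else x) ∈ matchings s t := by
  refine mem_matchings.2 ⟨fun x hx => ?_, fun x hx y hy hxy => ?_, ?_, fun x hx => ?_⟩
  · simpa [hx] using (h.excClose x).1 hx
  · simpa [Finset.mem_coe.1 hx, Finset.mem_coe.1 hy] using hxy
  · ext x
    rw [Finset.mem_image, h.exc]
    constructor
    · rintro ⟨c, hc, rfl⟩
      simpa [hc] using (h.excClose c).1 hc
    · intro hx
      have : σ x ∈ t := (h.excClose _).2 (by simpa using hx)
      exact ⟨σ x, this, by simp [this]⟩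
  · simp [hx]

omit [Fintype α] in
lemma HasArcs.inv {σ : Equiv.Perm α} {s t s' t' : Finset α} (h : HasArcs σ s t s' t') :
    HasArcs σ⁻¹ s' t' s t :=
  ⟨h.dropOpen, by simpa using h.drop, by simpa using h.exc, h.excClose⟩

lemma HasArcs.restrict_mem {σ : Equiv.Perm α} {s t s' t' : Finset α}
    (h : HasArcs σ s t s' t') : (fun x => if x ∈ t' then σ x else x) ∈ matchings s' t' := by
  simpa using h.inv.restrict_inv_mem

lemma exists_hasArcs {s t s' t' : Finset α} (hst : Disjoint s t') (hts : Disjoint t s')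
    (hu : s ∪ t' = t ∪ s') {g g' : α → α} (hg : g ∈ matchings s t)
    (hg' : g' ∈ matchings s' t') :
    ∃ σ : Equiv.Perm α, HasArcs σ s t s' t' ∧ (∀ x ∈ t, σ⁻¹ x = g x) ∧ ∀ x ∈ t', σ x = g' x := by
  obtain ⟨h1, h2, h3, -⟩ := mem_matchings.1 hg
  obtain ⟨h1', h2', h3', -⟩ := mem_matchings.1 hg'
  have hex : ∀ x ∈ s, ∃ c ∈ t, g c = x := fun x hx => by
    rw [← h3] at hx
    simpa using hx
  choose! k hk hgk using hex
  let f : α → α := fun x => if x ∈ t' then g' x else if x ∈ s then k x else x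
  have ft' : ∀ x ∈ t', f x = g' x := fun x hx => by simp [f, hx]
  have fs : ∀ x ∈ s, f x = k x := fun x hx => by
    simp [f, hx, Finset.disjoint_left.1 hst hx]
  have fo : ∀ x, x ∉ s → x ∉ t' → f x = x := fun x hx hx' => by simp [f, hx, hx']
  have mt' : ∀ x ∈ t', f x ∈ s' := fun x hx => by
    rw [ft' x hx, ← h3']; exact Finset.mem_image_of_mem _ hx
  have ms : ∀ x ∈ s, f x ∈ t := fun x hx => by rw [fs x hx]; exact hk x hx
  have mo : ∀ x, x ∉ s → x ∉ t' → x ∉ t ∧ x ∉ s' := fun x hx hx' => by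
    have : x ∉ s ∪ t' := by simp [hx, hx']
    rw [hu] at this
    simpa using this
  have hd : ∀ x ∈ t, x ∉ s' := fun x hx => Finset.disjoint_left.1 hts hx
  have hinj : Function.Injective f := by
    intro x y hxy
    by_cases hx' : x ∈ t' <;> by_cases hy' : y ∈ t'
    · rw [ft' x hx', ft' y hy'] at hxy
      exact h2' hx' hy' hxy
    · by_cases hy : y ∈ s
      · exact absurd (hxy ▸ mt' x hx') (hd _ (ms y hy))
      · have := mt' x hx'
        rw [hxy, fo y hy hy'] at this
        exact absurd this (mo y hy hy').2
    · by_cases hx : x ∈ s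
      · exact absurd (hxy ▸ mt' y hy') (hd _ (ms x hx))
      · have := mt' y hy'
        rw [← hxy, fo x hx hx'] at this
        exact absurd this (mo x hx hx').2
    · by_cases hx : x ∈ s <;> by_cases hy : y ∈ s
      · rw [fs x hx, fs y hy] at hxy
        rw [← hgk x hx, hxy, hgk y hy]
      · have := ms x hx
        rw [hxy, fo y hy hy'] at this
        exact absurd this (mo y hy hy').1
      · have := ms y hy
        rw [← hxy, fo x hx hx'] at this
        exact absurd this (mo x hx hx').1
      · rwa [fo x hx hx', fo y hy hy'] at hxy
  let σ : Equiv.Perm α := Equiv.ofBijective f (Finite.injective_iff_bijective.1 hinj)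
  have hσ : ∀ x, σ x = f x := fun x => rfl
  have lt' : ∀ x ∈ t', f x < x := fun x hx => by rw [ft' x hx]; exact h1' x hx
  have ls : ∀ x ∈ s, x < f x := fun x hx => by
    have := h1 _ (hk x hx)
    rwa [hgk x hx, ← fs x hx] at this
  have hcase : ∀ x, (x ∈ s ∧ x ∉ t' ∧ x < f x ∧ f x ∈ t ∧ f x ∉ s') ∨
      (x ∈ t' ∧ x ∉ s ∧ f x < x ∧ f x ∈ s' ∧ f x ∉ t) ∨
      (x ∉ s ∧ x ∉ t' ∧ f x = x ∧ f x ∉ t ∧ f x ∉ s') := by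
    intro x
    by_cases hx : x ∈ s
    · exact Or.inl ⟨hx, Finset.disjoint_left.1 hst hx, ls x hx, ms x hx, hd _ (ms x hx)⟩
    · by_cases hx' : x ∈ t'
      · exact Or.inr (Or.inl ⟨hx', hx, lt' x hx', mt' x hx', fun h => hd _ h (mt' x hx')⟩)
      · refine Or.inr (Or.inr ⟨hx, hx', fo x hx hx', ?_⟩)
        rw [fo x hx hx']
        exact mo x hx hx'
  refine ⟨σ, ⟨fun x => ?_, fun c => ?_, fun c => ?_, fun x => ?_⟩, fun c hc => ?_, fun x hx => ?_⟩
  · rw [hσ]; have := hcase x; grind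
  · obtain ⟨x, rfl⟩ := σ.surjective c
    rw [show σ⁻¹ (σ x) = x from σ.symm_apply_apply x, hσ]; have := hcase x; grind
  · obtain ⟨x, rfl⟩ := σ.surjective c
    rw [show σ⁻¹ (σ x) = x from σ.symm_apply_apply x, hσ]; have := hcase x; grind
  · rw [hσ]; have := hcase x; grind
  · have hs : g c ∈ s := by rw [← h3]; exact Finset.mem_image_of_mem _ hc
    rw [Equiv.Perm.inv_eq_iff_eq, hσ, fs _ hs]
    exact (h2 (hk _ hs) hc (hgk _ hs)).symm
  · rw [hσ, ft' x hx]

lemma sum_hasArcs {s t s' t' : Finset α} (hst : Disjoint s t') (hts : Disjoint t s')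
    (hu : s ∪ t' = t ∪ s') :
    ∑ σ : Equiv.Perm α with HasArcs σ s t s' t',
        matchWt p q True t (σ⁻¹ : Equiv.Perm α) * matchWt p q False t' σ =
      (∑ g ∈ matchings s t, matchWt p q True t g) *
        ∑ g ∈ matchings s' t', matchWt p q False t' g := by
  rw [Finset.sum_mul_sum, ← Finset.sum_product']
  refine Finset.sum_bij (fun σ _ => ((fun x => if x ∈ t then σ⁻¹ x else x),
    (fun x => if x ∈ t' then σ x else x))) ?_ ?_ ?_ ?_
  · intro σ hσ
    have hσ := (Finset.mem_filter.1 hσ).2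
    exact Finset.mem_product.2 ⟨hσ.restrict_inv_mem, hσ.restrict_mem⟩
  · intro σ hσ τ hτ h
    have hσ := (Finset.mem_filter.1 hσ).2
    have hτ := (Finset.mem_filter.1 hτ).2
    obtain ⟨ha, hb⟩ := Prod.mk.inj h
    ext x
    by_cases hx' : x ∈ t'
    · simpa [hx'] using congrFun hb x
    · by_cases hx : x ∈ s
      · have hmem : σ x ∈ t := (hσ.excClose _).2 (by simpa using (hσ.exc x).1 hx)
        have := congrFun ha (σ x)
        simp only [hmem, if_true, show σ⁻¹ (σ x) = x from σ.symm_apply_apply x] at this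
        exact (Equiv.Perm.eq_inv_iff_eq.1 this).symm
      · have e1 : σ x = x := le_antisymm (not_lt.1 fun h => hx ((hσ.exc x).2 h))
          (not_lt.1 fun h => hx' ((hσ.drop x).2 h))
        have e2 : τ x = x := le_antisymm (not_lt.1 fun h => hx ((hτ.exc x).2 h))
          (not_lt.1 fun h => hx' ((hτ.drop x).2 h))
        rw [e1, e2]
  · rintro ⟨g, g'⟩ hgg
    obtain ⟨hg, hg'⟩ := Finset.mem_product.1 hgg
    obtain ⟨σ, hσ, h1, h2⟩ := exists_hasArcs hst hts hu hg hg'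
    refine ⟨σ, by simpa using hσ, Prod.ext (funext fun x => ?_) (funext fun x => ?_)⟩
    · by_cases hx : x ∈ t
      · simpa [hx] using h1 x hx
      · simpa [hx] using ((mem_matchings.1 hg).2.2.2 x hx).symm
    · by_cases hx : x ∈ t'
      · simpa [hx] using h2 x hx
      · simpa [hx] using ((mem_matchings.1 hg').2.2.2 x hx).symm
  · intro σ hσ
    congr 1
    · exact matchWt_congr p q _ fun x hx => by simp [hx]
    · exact matchWt_congr p q _ fun x hx => by simp [hx]

/-- The nestings of a permutation. -/
def nestSet (σ : Equiv.Perm α) : Finset (α × α) :=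
  univ.filter fun x => (x.1 < x.2 ∧ x.2 ≤ σ x.2 ∧ σ x.2 < σ x.1) ∨
    (x.2 < x.1 ∧ σ x.2 < x.2 ∧ σ x.1 < σ x.2)

/-- The crossings of a permutation. -/
def crosSet (σ : Equiv.Perm α) : Finset (α × α) :=
  univ.filter fun x => (x.1 < x.2 ∧ x.2 ≤ σ x.1 ∧ σ x.1 < σ x.2) ∨
    (x.2 < x.1 ∧ σ x.1 < x.2 ∧ σ x.2 < σ x.1)

omit [LinearOrder α] in
lemma pow_card_filter_prod {S : Type*} [CommMonoid S] (r : S) (P : α → α → Prop)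
    [DecidableRel P] :
    r ^ #{x : α × α | P x.1 x.2} = ∏ x, ∏ y, if P x y then r else 1 := by
  rw [← Finset.prod_product', Finset.univ_product_univ, Finset.prod_ite]
  simp

lemma card_openArcs {σ : Equiv.Perm α} {s t s' t' : Finset α} (h : HasArcs σ s t s' t') {x : α}
    (hx : σ x = x) : #{y | y < x ∧ x < σ y} = #{y ∈ s | y < x} - #{y ∈ t | y < x} := by
  have h1 : #{y ∈ t | y < x} = #{y ∈ s | σ y < x} := by
    symm
    refine Finset.card_bij (fun y _ => σ y) ?_ ?_ ?_
    · intro y hy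
      obtain ⟨hy1, hy2⟩ := Finset.mem_filter.1 hy
      exact Finset.mem_filter.2 ⟨(h.excClose _).2 (by simpa using (h.exc y).1 hy1), hy2⟩
    · intro y _ z _ hyz
      exact σ.injective hyz
    · intro c hc
      obtain ⟨hc1, hc2⟩ := Finset.mem_filter.1 hc
      exact ⟨σ⁻¹ c, Finset.mem_filter.2
        ⟨(h.exc _).2 (by simpa using (h.excClose c).1 hc1), by simpa using hc2⟩, by simp⟩
  have h2 : ({y ∈ s | y < x} : Finset α) =
      {y ∈ s | σ y < x} ∪ ({y | y < x ∧ x < σ y} : Finset α) := by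
    ext y
    simp only [Finset.mem_filter, Finset.mem_union, h.exc, Finset.mem_univ, true_and]
    have hne : y ≠ x → σ y ≠ x := fun hyx he => hyx (σ.injective (he.trans hx.symm))
    constructor
    · rintro ⟨ha, hb⟩
      rcases lt_or_gt_of_ne (hne hb.ne) with hc | hc
      · exact Or.inl ⟨ha, hc⟩
      · exact Or.inr ⟨hb, hc⟩
    · rintro (⟨ha, hb⟩ | ⟨ha, hb⟩)
      · exact ⟨ha, ha.trans hb⟩
      · exact ⟨ha.trans hb, ha⟩
  have h3 : Disjoint ({y ∈ s | σ y < x} : Finset α) ({y | y < x ∧ x < σ y} : Finset α) := by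
    rw [Finset.disjoint_left]
    intro y hy hy'
    exact lt_asymm (Finset.mem_filter.1 hy).2 (Finset.mem_filter.1 hy').2.2
  rw [h2, Finset.card_union_of_disjoint h3, h1, Nat.add_sub_cancel_left]

lemma matchWt_eq_prod (b : Prop) (t : Finset α) (g : α → α) :
    matchWt p q b t g =
      ∏ c, ∏ d, if c ∈ t ∧ d ∈ t ∧ c < d then closeWt p q b c (g c) (g d) else 1 := by
  unfold matchWt
  simp_rw [ite_and, Finset.prod_filter]
  simp

lemma pow_nest_mul_pow_cros {σ : Equiv.Perm α} {s t s' t' : Finset α}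
    (h : HasArcs σ s t s' t') :
    p ^ #(nestSet σ) * q ^ #(crosSet σ) =
      matchWt p q True t (σ⁻¹ : Equiv.Perm α) * matchWt p q False t' σ *
        ∏ x ∈ (s ∪ t')ᶜ, p ^ (#{y ∈ s | y < x} - #{y ∈ t | y < x}) := by
  have e1 : matchWt p q True t (σ⁻¹ : Equiv.Perm α) = ∏ x, ∏ y,
      if x < σ x ∧ y < σ y ∧ σ x < σ y then closeWt p q True (σ x) x y else 1 := by
    rw [matchWt_eq_prod, ← Equiv.prod_comp σ]
    refine Finset.prod_congr rfl fun x _ => ?_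
    rw [← Equiv.prod_comp σ]
    simp [h.excClose]
  have e2 : ∏ x ∈ (s ∪ t')ᶜ, p ^ (#{y ∈ s | y < x} - #{y ∈ t | y < x}) =
      ∏ x, ∏ y, if σ x = x ∧ y < x ∧ x < σ y then p else 1 := by
    have hf : (s ∪ t')ᶜ = univ.filter fun x => σ x = x := by
      ext x
      simp only [Finset.mem_compl, Finset.mem_union, h.exc, h.drop, Finset.mem_filter,
        Finset.mem_univ, true_and, not_or, not_lt]
      exact ⟨fun h => le_antisymm h.1 h.2, fun h => ⟨h.le, h.ge⟩⟩
    rw [hf, Finset.prod_filter]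
    refine Finset.prod_congr rfl fun x _ => ?_
    split_ifs with hx
    · rw [← card_openArcs h hx]
      simp [hx, Finset.prod_ite]
    · simp [hx]
  have e3 : p ^ #(nestSet σ) = ∏ x, ∏ y,
      if (y < x ∧ x ≤ σ x ∧ σ x < σ y) ∨ (x < y ∧ σ x < x ∧ σ y < σ x) then p else 1 := by
    rw [nestSet, pow_card_filter_prod p fun x y => (x < y ∧ y ≤ σ y ∧ σ y < σ x) ∨
      (y < x ∧ σ y < y ∧ σ x < σ y), Finset.prod_comm]
  have e4 : q ^ #(crosSet σ) =
      (∏ x, ∏ y, if x < y ∧ y ≤ σ x ∧ σ x < σ y then q else 1) *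
        ∏ x, ∏ y, if x < y ∧ σ y < x ∧ σ x < σ y then q else 1 := by
    rw [crosSet, pow_card_filter_prod q fun x y => (x < y ∧ y ≤ σ x ∧ σ x < σ y) ∨
      (y < x ∧ σ x < y ∧ σ y < σ x)]
    conv_rhs => rw [mul_comm, Finset.prod_comm, mul_comm]
    simp_rw [← Finset.prod_mul_distrib]
    refine Finset.prod_congr rfl fun x _ => Finset.prod_congr rfl fun y _ => ?_
    by_cases h1 : x < y
    · simp [h1, not_lt.2 h1.le]
    · simp [h1]
  rw [e1, e2, e3, e4, matchWt_eq_prod]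
  simp_rw [← Finset.prod_mul_distrib, h.drop]
  refine Finset.prod_congr rfl fun x _ => Finset.prod_congr rfl fun y _ => ?_
  have hxy : σ x = σ y ↔ x = y := σ.injective.eq_iff
  unfold closeWt
  clear e1 e2 e3 e4 h
  generalize σ x = a at *
  generalize σ y = b at *
  grind (splits := 30)

end Permutations

section CycleTypes

variable {α R : Type*} [LinearOrder α] [Fintype α] [CommRing R] (p q : R)

/-- The number of arcs passing over `x`, given the cyclic valleys `V` and the cyclic peaks `P`. -/
def openCount (V P : Finset α) (x : α) : ℕ := #{y ∈ V | y < x} - #{y ∈ P | y < x}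

/-- The weight of a set `V` of cyclic valleys, `P` of cyclic peaks and `C` of double drops. -/
def historyWt (V P C : Finset α) : R :=
  if #V = #P then
    (∏ x ∈ P, openInt p q (openCount V P x)) ^ 2 * (∏ x ∈ C, openInt p q (openCount V P x)) *
      ∏ x ∈ (V ∪ P ∪ C)ᶜ, p ^ openCount V P x
  else 0

omit [Fintype α] in
lemma card_filter_union_sub {V P A : Finset α} (hVA : Disjoint V A) (hPA : Disjoint P A) (x : α) :
    #{y ∈ V ∪ A | y < x} - #{y ∈ P ∪ A | y < x} = openCount V P x := by
  rw [Finset.filter_union, Finset.filter_union,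
    Finset.card_union_of_disjoint (Finset.disjoint_filter_filter hVA),
    Finset.card_union_of_disjoint (Finset.disjoint_filter_filter hPA), Nat.add_sub_add_right]
  rfl

lemma prod_union_openInt {V P A : Finset α} (b : Prop) (hVP : Disjoint V P) (hVA : Disjoint V A)
    (hPA : Disjoint P A) (hc : #V = #P) :
    ∑ g ∈ matchings (V ∪ A) (P ∪ A), matchWt p q b (P ∪ A) g =
      (if b then q ^ #A else 1) * ((∏ x ∈ P, openInt p q (openCount V P x)) *
        ∏ x ∈ A, openInt p q (openCount V P x)) := by
  rw [sum_matchings p q b _ _ (by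
      rw [Finset.card_union_of_disjoint hVA, Finset.card_union_of_disjoint hPA, hc]),
    Finset.prod_congr rfl fun x _ => by rw [card_filter_union_sub hVA hPA],
    Finset.prod_union hPA, Finset.prod_mul_distrib, Finset.prod_mul_distrib]
  have h1 : ∏ x ∈ P, (if b ∧ x ∈ V ∪ A then q else 1) = 1 :=
    Finset.prod_eq_one fun x hx => by
      simp [Finset.disjoint_right.1 hVP hx, Finset.disjoint_left.1 hPA hx]
  have h2 : ∏ x ∈ A, (if b ∧ x ∈ V ∪ A then q else 1) = if b then q ^ #A else 1 := by
    by_cases hb : b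
    · rw [if_pos hb]
      exact Finset.prod_eq_pow_card fun x hx => by simp [hx, hb]
    · simp [hb]
  rw [h1, h2]
  ring

theorem sum_hasArcs_nest_cros {V P C A : Finset α} (hVP : Disjoint V P) (hVC : Disjoint V C)
    (hPC : Disjoint P C) (hA : A ⊆ C) :
    ∑ σ : Equiv.Perm α with HasArcs σ (V ∪ A) (P ∪ A) (V ∪ C \ A) (P ∪ C \ A),
        p ^ #(nestSet σ) * q ^ #(crosSet σ) = q ^ #A * historyWt p q V P C := by
  have hVA : Disjoint V A := hVC.mono_right hA
  have hPA : Disjoint P A := hPC.mono_right hA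
  have hVB : Disjoint V (C \ A) := hVC.mono_right Finset.sdiff_subset
  have hPB : Disjoint P (C \ A) := hPC.mono_right Finset.sdiff_subset
  have hAB : Disjoint A (C \ A) := Finset.disjoint_sdiff
  by_cases hc : #V = #P
  · have hu : V ∪ A ∪ (P ∪ C \ A) = V ∪ P ∪ C := by
      rw [Finset.union_union_union_comm, Finset.union_sdiff_of_subset hA]
    have hu' : P ∪ A ∪ (V ∪ C \ A) = V ∪ P ∪ C := by
      rw [Finset.union_union_union_comm, Finset.union_sdiff_of_subset hA, Finset.union_comm P]
    rw [Finset.sum_congr rfl fun σ hσ =>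
      pow_nest_mul_pow_cros p q (Finset.mem_filter.1 hσ).2, ← Finset.sum_mul, sum_hasArcs p q
      (by simp [Finset.disjoint_union_left, Finset.disjoint_union_right, *, hPA.symm])
      (by simp [Finset.disjoint_union_left, Finset.disjoint_union_right, *, hVP.symm, hVA.symm])
      (hu.trans hu'.symm), hu, prod_union_openInt p q True hVP hVA hPA hc,
      prod_union_openInt p q False hVP hVB hPB hc,
      historyWt, if_pos hc, ← Finset.prod_sdiff hA]
    simp only [if_true, if_false, card_filter_union_sub hVA hPA]
    ring
  · rw [historyWt, if_neg hc, mul_zero]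
    refine Finset.sum_eq_zero fun σ hσ => absurd ?_ hc
    have := card_eq_of_mem_matchings (Finset.mem_filter.1 hσ).2.restrict_inv_mem
    rwa [Finset.card_union_of_disjoint hVA, Finset.card_union_of_disjoint hPA,
      Nat.add_right_cancel_iff] at this

/-- The cyclic valleys of a permutation. -/
def cvalleySet (σ : Equiv.Perm α) : Finset α := {x | x < σ⁻¹ x ∧ x < σ x}

/-- The cyclic peaks of a permutation. -/
def cpeakSet (σ : Equiv.Perm α) : Finset α := {x | σ⁻¹ x < x ∧ σ x < x}

/-- The double excedances of a permutation. -/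
def cdaSet (σ : Equiv.Perm α) : Finset α := {x | σ⁻¹ x < x ∧ x < σ x}

/-- The double drops of a permutation. -/
def cddSet (σ : Equiv.Perm α) : Finset α := {x | x < σ⁻¹ x ∧ σ x < x}

/-- The cyclic valleys, the cyclic peaks, and the other non-fixed points. -/
def shape (σ : Equiv.Perm α) : Finset α × Finset α × Finset α :=
  (cvalleySet σ, cpeakSet σ, cdaSet σ ∪ cddSet σ)

omit [LinearOrder α] [Fintype α] in
lemma inv_apply_eq_iff (σ : Equiv.Perm α) (x : α) : σ⁻¹ x = x ↔ σ x = x := by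
  rw [Equiv.Perm.inv_eq_iff_eq, eq_comm]

lemma shape_eq_iff {V P C A : Finset α} (hVP : Disjoint V P) (hVC : Disjoint V C)
    (hPC : Disjoint P C) (hA : A ⊆ C) (σ : Equiv.Perm α) :
    shape σ = (V, P, C) ∧ cdaSet σ = A ↔
      HasArcs σ (V ∪ A) (P ∪ A) (V ∪ C \ A) (P ∪ C \ A) := by
  have hi := inv_apply_eq_iff σ
  rw [Finset.disjoint_left] at hVP hVC hPC
  constructor
  · rintro ⟨h1, rfl⟩
    simp only [shape, Prod.mk.injEq] at h1
    obtain ⟨rfl, rfl, rfl⟩ := h1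
    constructor <;> intro x <;> have := hi x <;>
      simp only [Finset.mem_union, Finset.mem_sdiff, cvalleySet, cpeakSet, cdaSet, cddSet,
        Finset.mem_filter, Finset.mem_univ, true_and] <;> grind
  · intro h
    simp only [shape, Prod.mk.injEq, Finset.ext_iff, Finset.mem_union, cvalleySet, cpeakSet, cdaSet,
      cddSet, Finset.mem_filter, Finset.mem_univ, true_and, ← h.exc, ← h.excClose, ← h.drop,
      ← h.dropOpen, Finset.mem_sdiff]
    have hA := fun x => @hA x
    refine ⟨⟨fun x => ?_, fun x => ?_, fun x => ?_⟩, fun x => ?_⟩ <;>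
      have := hA x <;> have := @hVP x <;> have := @hVC x <;> have := @hPC x <;> tauto

theorem sum_shape_eq (k : Finset α × Finset α × Finset α) (A : Finset α) :
    ∑ σ : Equiv.Perm α with shape σ = k ∧ cdaSet σ = A, p ^ #(nestSet σ) * q ^ #(crosSet σ) =
      if A ⊆ k.2.2 then
        q ^ #A * ∑ σ : Equiv.Perm α with shape σ = k ∧ cdaSet σ = ∅,
          p ^ #(nestSet σ) * q ^ #(crosSet σ)
      else 0 := by
  obtain ⟨V, P, C⟩ := k
  by_cases hd : Disjoint V P ∧ Disjoint V C ∧ Disjoint P C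
  · obtain ⟨hVP, hVC, hPC⟩ := hd
    split_ifs with hA
    · simp_rw [shape_eq_iff hVP hVC hPC hA, shape_eq_iff hVP hVC hPC (Finset.empty_subset C)]
      rw [sum_hasArcs_nest_cros p q hVP hVC hPC hA,
        sum_hasArcs_nest_cros p q hVP hVC hPC (Finset.empty_subset C)]
      simp
    · rw [Finset.filter_false_of_mem, Finset.sum_empty]
      rintro σ - ⟨h1, rfl⟩
      simp only [shape, Prod.mk.injEq] at h1
      exact hA (h1.2.2 ▸ Finset.subset_union_left)
  · have hempty : ∀ B, (univ.filter fun σ : Equiv.Perm α =>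
        shape σ = (V, P, C) ∧ cdaSet σ = B) = ∅ := by
      intro B
      refine Finset.filter_false_of_mem ?_
      rintro σ - ⟨h1, -⟩
      simp only [shape, Prod.mk.injEq] at h1
      obtain ⟨rfl, rfl, rfl⟩ := h1
      refine hd ⟨?_, ?_, ?_⟩ <;> rw [Finset.disjoint_left] <;> intro x <;>
        simp only [Finset.mem_union, cvalleySet, cpeakSet, cdaSet, cddSet, Finset.mem_filter,
          Finset.mem_univ, true_and] <;> grind
    simp [hempty]

/-- Double excedances can be traded for double drops, whatever the weight `F` of the shape is. -/
theorem sum_pow_cda_cdd (F : Finset α × Finset α × Finset α → R) (u v : R) :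
    ∑ σ : Equiv.Perm α, p ^ #(nestSet σ) * q ^ #(crosSet σ) *
        (F (shape σ) * u ^ #(cdaSet σ) * v ^ #(cddSet σ)) =
      ∑ σ : Equiv.Perm α with cdaSet σ = ∅, p ^ #(nestSet σ) * q ^ #(crosSet σ) *
        (F (shape σ) * (q * u + v) ^ #(cddSet σ)) := by
  have hcard : ∀ σ : Equiv.Perm α, #(cddSet σ) = #(shape σ).2.2 - #(cdaSet σ) := by
    intro σ
    rw [shape, Finset.card_union_of_disjoint, Nat.add_sub_cancel_left]
    rw [Finset.disjoint_left]
    intro x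
    simp only [cdaSet, cddSet, Finset.mem_filter, Finset.mem_univ, true_and]
    exact fun h h' => lt_asymm h.1 h'.1
  rw [← Finset.sum_fiberwise _ shape, ← Finset.sum_fiberwise (univ.filter _) shape]
  refine Finset.sum_congr rfl fun k _ => ?_
  rw [← Finset.sum_fiberwise _ cdaSet]
  have hinner : ∀ A : Finset α, ∑ σ ∈ ({σ | shape σ = k} : Finset (Equiv.Perm α)) with
      cdaSet σ = A, p ^ #(nestSet σ) * q ^ #(crosSet σ) *
        (F (shape σ) * u ^ #(cdaSet σ) * v ^ #(cddSet σ)) =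
      if A ⊆ k.2.2 then (∑ σ : Equiv.Perm α with shape σ = k ∧ cdaSet σ = ∅,
          p ^ #(nestSet σ) * q ^ #(crosSet σ)) * F k *
            ((q * u) ^ #A * v ^ (#k.2.2 - #A)) else 0 := by
    intro A
    rw [Finset.filter_filter]
    trans (∑ σ : Equiv.Perm α with shape σ = k ∧ cdaSet σ = A,
          p ^ #(nestSet σ) * q ^ #(crosSet σ)) * (F k * u ^ #A * v ^ (#k.2.2 - #A))
    · rw [Finset.sum_mul]
      refine Finset.sum_congr rfl fun σ hσ => ?_
      obtain ⟨h1, h2⟩ := (Finset.mem_filter.1 hσ).2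
      rw [hcard, h1, h2]
    · rw [sum_shape_eq]
      split_ifs <;> ring
  rw [Finset.sum_congr rfl fun A _ => hinner A, ← Finset.sum_filter, ← Finset.mul_sum]
  have hpow : (univ.filter fun A : Finset α => A ⊆ k.2.2) = k.2.2.powerset := by
    ext A; simp
  rw [hpow, Finset.sum_pow_mul_eq_add_pow, Finset.filter_filter, Finset.sum_mul, Finset.sum_mul]
  refine Finset.sum_congr (Finset.filter_congr fun σ _ => and_comm) fun σ hσ => ?_
  obtain ⟨h2, h1⟩ := (Finset.mem_filter.1 hσ).2
  rw [hcard, h1, h2]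
  simp [mul_assoc]

end CycleTypes

section Statistics

variable {α : Type*} [LinearOrder α] [Fintype α]

lemma card_drop (σ : Equiv.Perm α) : #{x | σ x < x} = #(cpeakSet σ) + #(cddSet σ) := by
  rw [cpeakSet, cddSet, ← Finset.card_union_of_disjoint]
  · congr 1
    ext x
    have := inv_apply_eq_iff σ x
    simp only [Finset.mem_union, Finset.mem_filter, Finset.mem_univ, true_and]
    grind
  · rw [Finset.disjoint_left]
    intro x
    simp only [Finset.mem_filter, Finset.mem_univ, true_and]
    exact fun h h' => lt_asymm h.1 h'.1

lemma card_dropOpen (σ : Equiv.Perm α) : #{x | x < σ⁻¹ x} = #(cvalleySet σ) + #(cddSet σ) := by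
  rw [cvalleySet, cddSet, ← Finset.card_union_of_disjoint]
  · congr 1
    ext x
    have := inv_apply_eq_iff σ x
    simp only [Finset.mem_union, Finset.mem_filter, Finset.mem_univ, true_and]
    grind
  · rw [Finset.disjoint_left]
    intro x
    simp only [Finset.mem_filter, Finset.mem_univ, true_and]
    exact fun h h' => lt_asymm h.2 h'.2

lemma card_drop_eq_card_dropOpen (σ : Equiv.Perm α) : #{x | σ x < x} = #{x | x < σ⁻¹ x} := by
  refine Finset.card_bij (fun x _ => σ x) (by simp) (fun x _ y _ h => σ.injective h) ?_
  intro y hy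
  exact ⟨σ⁻¹ y, by simpa using hy, by simp⟩

lemma card_cpeakSet (σ : Equiv.Perm α) : #(cpeakSet σ) = #(cvalleySet σ) := by
  have := card_drop σ
  have := card_dropOpen σ
  have := card_drop_eq_card_dropOpen σ
  omega

/-- The number of fixed points of a permutation with the given shape. -/
def fixCount (k : Finset α × Finset α × Finset α) : ℕ := #(k.1 ∪ k.2.1 ∪ k.2.2)ᶜ

lemma fixCount_shape (σ : Equiv.Perm α) : fixCount (shape σ) = #{x | σ x = x} := by
  unfold fixCount
  congr 1
  ext x
  have := inv_apply_eq_iff σ x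
  simp only [shape, cvalleySet, cpeakSet, cdaSet, cddSet, Finset.mem_compl, Finset.mem_union,
    Finset.mem_filter, Finset.mem_univ, true_and]
  grind

lemma card_eq_add_fixCount (σ : Equiv.Perm α) :
    2 * #(cvalleySet σ) + #(cdaSet σ) + #(cddSet σ) + fixCount (shape σ) = Fintype.card α := by
  have h : ∀ x, (if x < σ⁻¹ x ∧ x < σ x then 1 else 0) + (if σ⁻¹ x < x ∧ σ x < x then 1 else 0) +
      (if σ⁻¹ x < x ∧ x < σ x then 1 else 0) + (if x < σ⁻¹ x ∧ σ x < x then 1 else 0) +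
      (if σ x = x then 1 else 0) = 1 := by
    intro x
    have := inv_apply_eq_iff σ x
    grind
  rw [fixCount_shape, two_mul]
  nth_rewrite 2 [← card_cpeakSet]
  rw [cvalleySet, cpeakSet, cdaSet, cddSet]
  simp only [Finset.card_filter, ← Finset.sum_add_distrib]
  rw [Finset.sum_congr rfl fun x _ => h x]
  simp

lemma pext_succ {n : ℕ} (σ : Equiv.Perm (Fin n)) (x : Fin n) :
    pext n σ (x + 1) = (σ x : ℕ) + 1 := by
  simp [pext]

lemma card_filter_Icc_one (n : ℕ) (P : ℕ → Prop) [DecidablePred P] :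
    #{i ∈ Finset.Icc 1 n | P i} = #{x : Fin n | P (x + 1)} := by
  symm
  refine Finset.card_bij (fun x _ => (x : ℕ) + 1) ?_ ?_ ?_
  · intro x hx
    simp only [Finset.mem_filter, Finset.mem_univ, true_and] at hx
    simp only [Finset.mem_filter, Finset.mem_Icc]
    exact ⟨⟨by omega, by omega⟩, hx⟩
  · intro x _ y _ h
    exact Fin.ext (by simpa using h)
  · intro i hi
    simp only [Finset.mem_filter, Finset.mem_Icc] at hi
    have h1 : i - 1 + 1 = i := by omega
    exact ⟨⟨i - 1, by omega⟩, by simpa [h1] using hi.2, h1⟩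

lemma card_filter_pairs (n : ℕ) (P : ℕ × ℕ → Prop) [DecidablePred P] :
    #{z ∈ pairs n | P z} = #{z : Fin n × Fin n | P (z.1 + 1, z.2 + 1)} := by
  symm
  refine Finset.card_bij (fun z _ => ((z.1 : ℕ) + 1, (z.2 : ℕ) + 1)) ?_ ?_ ?_
  · intro z hz
    simp only [Finset.mem_filter, Finset.mem_univ, true_and] at hz
    simp only [Finset.mem_filter, pairs, Finset.mem_product, Finset.mem_Icc]
    exact ⟨⟨⟨by omega, by omega⟩, by omega, by omega⟩, hz⟩
  · intro x _ y _ h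
    simp only [Prod.mk.injEq, Nat.add_right_cancel_iff] at h
    exact Prod.ext (Fin.ext h.1) (Fin.ext h.2)
  · rintro ⟨i, j⟩ hi
    simp only [Finset.mem_filter, pairs, Finset.mem_product, Finset.mem_Icc] at hi
    have h1 : i - 1 + 1 = i := by omega
    have h2 : j - 1 + 1 = j := by omega
    exact ⟨(⟨i - 1, by omega⟩, ⟨j - 1, by omega⟩), by simpa [h1, h2] using hi.2,
      Prod.ext h1 h2⟩

variable {n : ℕ} (σ : Equiv.Perm (Fin n))

lemma nestStat_eq : nestStat n σ = #(nestSet σ) := by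
  rw [nestStat, card_filter_pairs, nestSet]
  congr 1
  ext x
  simp [pext_succ]

lemma crosStat_eq : crosStat n σ = #(crosSet σ) := by
  rw [crosStat, card_filter_pairs, crosSet]
  congr 1
  ext x
  simp [pext_succ]

lemma cvalleyStat_eq : cvalleyStat n σ = #(cvalleySet σ) := by
  rw [cvalleyStat, card_filter_Icc_one, cvalleySet]
  congr 1
  ext x
  simp [pext_succ]

lemma cdaStat_eq : cdaStat n σ = #(cdaSet σ) := by
  rw [cdaStat, card_filter_Icc_one, cdaSet]
  congr 1
  ext x
  simp [pext_succ]

lemma cddStat_eq : cddStat n σ = #(cddSet σ) := by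
  rw [cddStat, card_filter_Icc_one, cddSet]
  congr 1
  ext x
  simp [pext_succ]

lemma dropStat_eq : dropStat n σ = #(cvalleySet σ) + #(cddSet σ) := by
  rw [dropStat, card_filter_Icc_one, ← card_cpeakSet, ← card_drop]
  congr 1
  ext x
  simp [pext_succ]

lemma fixStat_eq : fixStat n σ = fixCount (shape σ) := by
  rw [fixStat, card_filter_Icc_one, fixCount_shape]
  congr 1
  ext x
  simp [pext_succ, Fin.ext_iff]

lemma card_eq_add_fixStat :
    2 * cvalleyStat n σ + cdaStat n σ + cddStat n σ + fixStat n σ = n := by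
  rw [cvalleyStat_eq, cdaStat_eq, cddStat_eq, fixStat_eq, card_eq_add_fixCount, Fintype.card_fin]

end Statistics

open MvPolynomial in
lemma sum_bPoly7 (n : ℕ) (y z x : MvPolynomial (Fin 7) ℤ) :
    ∑ j ∈ Finset.range (n + 1), y ^ j * ∑ k ∈ Finset.range ((n - j) / 2 + 1),
        bPoly7 n k j * z ^ k * x ^ (n - j - 2 * k) =
      ∑ σ : Equiv.Perm (Fin n) with cdaSet σ = ∅,
        X 0 ^ #(nestSet σ) * X 1 ^ #(crosSet σ) *
          (z ^ #(shape σ).1 * y ^ fixCount (shape σ) * x ^ #(cddSet σ)) := by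
  have hb : ∀ j k, bPoly7 n k j = ∑ σ : Equiv.Perm (Fin n) with cdaSet σ = ∅,
      if fixStat n σ = j then if cvalleyStat n σ = k then
        (X 0 ^ #(nestSet σ) * X 1 ^ #(crosSet σ) : MvPolynomial (Fin 7) ℤ) else 0 else 0 := by
    intro j k
    rw [bPoly7, Finset.sum_filter, Finset.sum_filter]
    refine Finset.sum_congr rfl fun σ _ => ?_
    have h0 : cdaStat n σ = 0 ↔ cdaSet σ = ∅ := by rw [cdaStat_eq, Finset.card_eq_zero]
    rw [nestStat_eq, crosStat_eq]
    split_ifs <;> first | rfl | tauto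
  simp_rw [hb, Finset.sum_mul, Finset.mul_sum]
  rw [Finset.sum_congr rfl fun j _ => Finset.sum_comm, Finset.sum_comm]
  refine Finset.sum_congr rfl fun σ hσ => ?_
  have hcard := card_eq_add_fixStat σ
  have h0 : cdaStat n σ = 0 := by rw [cdaStat_eq, (Finset.mem_filter.1 hσ).2, Finset.card_empty]
  rw [Finset.sum_eq_single (fixStat n σ), Finset.sum_eq_single (cvalleyStat n σ)]
  · rw [if_pos rfl, if_pos rfl,
      show n - fixStat n σ - 2 * cvalleyStat n σ = cddStat n σ by omega, cddStat_eq, fixStat_eq,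
      cvalleyStat_eq, shape]
    ring
  · intro k _ hk
    simp [hk.symm]
  · intro hk
    exact absurd (Finset.mem_range.2 (by omega)) hk
  · intro j _ hj
    simp [hj.symm]
  · intro hj
    exact absurd (Finset.mem_range.2 (by omega)) hj

open MvPolynomial in
theorem statement7 (n : ℕ) (hn : 1 ≤ n) :
    (∑ σ : Equiv.Perm (Fin n),
        (X 0 : MvPolynomial (Fin 7) ℤ) ^ nestStat n σ * X 1 ^ crosStat n σ *
          X 2 ^ dropStat n σ * X 3 ^ cdaStat n σ * X 4 ^ cddStat n σ *
          X 5 ^ cvalleyStat n σ * X 6 ^ fixStat n σ) =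
      ∑ j ∈ Finset.range (n + 1), (X 6 : MvPolynomial (Fin 7) ℤ) ^ j *
        ∑ k ∈ Finset.range ((n - j) / 2 + 1),
          bPoly7 n k j * (X 2 * X 5) ^ k *
            (X 1 * X 3 + X 2 * X 4) ^ (n - j - 2 * k) := by
  rw [sum_bPoly7]
  have h := sum_pow_cda_cdd (α := Fin n) (X 0 : MvPolynomial (Fin 7) ℤ) (X 1)
    (fun k => (X 2 * X 5) ^ #k.1 * X 6 ^ fixCount k) (X 3) (X 2 * X 4)
  rw [← h]
  refine Finset.sum_congr rfl fun σ _ => ?_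
  rw [nestStat_eq, crosStat_eq, dropStat_eq, cdaStat_eq, cddStat_eq, cvalleyStat_eq, fixStat_eq,
    shape]
  ring

end SZpaper
end
end
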